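/- Let d ≥ 2 and p₀ = 2(d+1)/(d+3). There exists a constant C > 0 (depending only on d, and independent of R) such that for every R > 0 and every Schwartz function f on ℝ^d, ( R^{d−1} ∫_{𝕊^{d−1}} |f̂(R ω)|² dσ(ω) )^{1/2} ≤ C R^{α} ‖f‖_{L^{p₀}(ℝ^d)}, where α = (d−1)/(2(d+1)) and dσ is the surface measure on the unit sphere 𝕊^{d−1} ⊂ ℝ^d. -/

import Mathlib

open MeasureTheory Complex Metric
open scoped ENNReal RealInnerProductSpace

noncomputable section

/-- Fourier transform `f̂(ξ) = ∫ e^{-i x·ξ} f(x) dx` on `ℝⁿ`. -/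
def fourierTf {n : ℕ} (f : EuclideanSpace ℝ (Fin n) → ℂ) (ξ : EuclideanSpace ℝ (Fin n)) : ℂ :=
  ∫ x : EuclideanSpace ℝ (Fin n), Complex.exp (-Complex.I * Complex.ofReal ⟪x, ξ⟫) * f x

namespace ST

/-- Euclidean space. -/
abbrev E (n : ℕ) := EuclideanSpace ℝ (Fin n)

/-- surface measure. -/
abbrev sg (n : ℕ) : Measure (sphere (0 : E n) 1) := (volume : Measure (E n)).toSphere

/-- isometry acting on the sphere -/
def rotS {n : ℕ} (L : E n ≃ₗᵢ[ℝ] E n) (ω : sphere (0 : E n) 1) : sphere (0 : E n) 1 :=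
  ⟨L ω, by simp⟩

lemma rotS_cont {n : ℕ} (L : E n ≃ₗᵢ[ℝ] E n) : Continuous (rotS L) := by
  unfold rotS
  fun_prop

open scoped Pointwise in
lemma rotS_mp {n : ℕ} (L : E n ≃ₗᵢ[ℝ] E n) : MeasurePreserving (rotS L) (sg n) (sg n) := by
  refine ⟨(rotS_cont L).measurable, ?_⟩
  ext s hs
  rw [Measure.map_apply (rotS_cont L).measurable hs,
    Measure.toSphere_apply' _ ((rotS_cont L).measurable hs), Measure.toSphere_apply' _ hs]
  congr 1
  have hmp : MeasurePreserving L.toMeasurableEquiv (volume : Measure (E n)) volume := L.measurePreserving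
  rw [← hmp.measure_preimage_equiv (Set.Ioo (0:ℝ) 1 • (Subtype.val '' s))]
  congr 1
  ext x
  have hLx : L.toMeasurableEquiv x = L x := rfl
  rw [Set.mem_preimage, hLx]
  simp only [Set.mem_smul, Set.mem_preimage, Set.mem_image]
  constructor
  · rintro ⟨a, ha, y, ⟨w, hw, rfl⟩, rfl⟩
    exact ⟨a, ha, L w, ⟨_, hw, rfl⟩, by rw [map_smul]⟩
  · rintro ⟨a, ha, y, ⟨w, hw, rfl⟩, h⟩
    refine ⟨a, ha, L.symm w, ⟨rotS L.symm w, ?_, rfl⟩, ?_⟩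
    · convert hw
      ext1
      simp [rotS]
    · apply L.injective
      rw [map_smul]
      simpa using h

lemma integral_rot {n : ℕ} (L : E n ≃ₗᵢ[ℝ] E n) (F : E n → ℝ) (hF : Continuous F) :
    ∫ ω, F (L (ω : E n)) ∂(sg n) = ∫ ω, F (ω : E n) ∂(sg n) := by
  have := (rotS_mp L).map_eq
  conv_rhs => rw [← this]
  rw [integral_map (rotS_cont L).measurable.aemeasurable (by
    apply Continuous.aestronglyMeasurable; fun_prop)]
  rfl

lemma integrable_sphere {n : ℕ} {G : Type*} [NormedAddCommGroup G] (F : sphere (0 : E n) 1 → G) (hF : Continuous F) :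
    Integrable F (sg n) := by
  have : IsCompact (Set.univ : Set (sphere (0 : E n) 1)) := isCompact_univ
  rw [← integrableOn_univ]
  exact hF.continuousOn.integrableOn_compact this

/-- derivative in direction v of cosine -/
lemma deriv_cos {n : ℕ} (x v : E n) (s : ℝ) :
    HasDerivAt (fun s : ℝ => ∫ ω, Real.cos ⟪x + s • v, (ω : E n)⟫ ∂(sg n))
      (-∫ ω, ⟪v, (ω : E n)⟫ * Real.sin ⟪x + s • v, (ω : E n)⟫ ∂(sg n)) s := by
  rw [← integral_neg]
  refine (hasDerivAt_integral_of_dominated_loc_of_deriv_le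
    (F := fun s (ω : sphere (0 : E n) 1) => Real.cos ⟪x + s • v, (ω : E n)⟫)
    (F' := fun s (ω : sphere (0 : E n) 1) => -(⟪v, (ω : E n)⟫ * Real.sin ⟪x + s • v, (ω : E n)⟫))
    (bound := fun _ => ‖v‖) (s := Set.univ) Filter.univ_mem ?_ ?_ ?_ ?_ ?_ ?_).2
  · exact Filter.Eventually.of_forall fun s => Continuous.aestronglyMeasurable (by fun_prop)
  · exact integrable_sphere _ (by fun_prop)
  · exact Continuous.aestronglyMeasurable (by fun_prop)
  · refine Filter.Eventually.of_forall fun ω s _ => ?_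
    have h1 : |⟪v, (ω : E n)⟫| ≤ ‖v‖ := by
      have := abs_real_inner_le_norm v (ω : E n)
      simpa using this
    have h2 := Real.abs_sin_le_one ⟪x + s • v, (ω : E n)⟫
    rw [norm_neg, norm_mul, Real.norm_eq_abs, Real.norm_eq_abs]
    calc _ ≤ ‖v‖ * 1 := mul_le_mul h1 h2 (abs_nonneg _) (norm_nonneg _)
      _ = _ := mul_one _
  · exact integrable_const _
  · refine Filter.Eventually.of_forall fun ω s _ => ?_
    have h1 : HasDerivAt (fun s : ℝ => ⟪x + s • v, (ω : E n)⟫) ⟪v, (ω : E n)⟫ s := by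
      have : (fun s : ℝ => ⟪x + s • v, (ω : E n)⟫) = fun s : ℝ => ⟪x, (ω : E n)⟫ + s * ⟪v, (ω : E n)⟫ := by
        ext s; rw [inner_add_left, real_inner_smul_left]
      rw [this]
      simpa using ((hasDerivAt_id s).mul_const ⟪v, (ω : E n)⟫).const_add ⟪x, (ω : E n)⟫
    refine h1.cos.congr_deriv ?_
    ring

lemma deriv_sin {n : ℕ} (x v : E n) (s : ℝ) :
    HasDerivAt (fun s : ℝ => ∫ ω, ⟪v, (ω : E n)⟫ * Real.sin ⟪x + s • v, (ω : E n)⟫ ∂(sg n))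
      (∫ ω, ⟪v, (ω : E n)⟫ ^ 2 * Real.cos ⟪x + s • v, (ω : E n)⟫ ∂(sg n)) s := by
  refine (hasDerivAt_integral_of_dominated_loc_of_deriv_le
    (F := fun s (ω : sphere (0 : E n) 1) => ⟪v, (ω : E n)⟫ * Real.sin ⟪x + s • v, (ω : E n)⟫)
    (F' := fun s (ω : sphere (0 : E n) 1) => ⟪v, (ω : E n)⟫ ^ 2 * Real.cos ⟪x + s • v, (ω : E n)⟫)
    (bound := fun _ => ‖v‖ ^ 2) (s := Set.univ) Filter.univ_mem ?_ ?_ ?_ ?_ ?_ ?_).2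
  · exact Filter.Eventually.of_forall fun s => Continuous.aestronglyMeasurable (by fun_prop)
  · exact integrable_sphere _ (by fun_prop)
  · exact Continuous.aestronglyMeasurable (by fun_prop)
  · refine Filter.Eventually.of_forall fun ω s _ => ?_
    have h1 : |⟪v, (ω : E n)⟫| ≤ ‖v‖ := by
      have := abs_real_inner_le_norm v (ω : E n)
      simpa using this
    have h2 := Real.abs_cos_le_one ⟪x + s • v, (ω : E n)⟫
    rw [norm_mul, norm_pow, Real.norm_eq_abs, Real.norm_eq_abs]
    calc _ ≤ ‖v‖ ^ 2 * 1 := mul_le_mul (by gcongr) h2 (abs_nonneg _) (by positivity)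
      _ = _ := mul_one _
  · exact integrable_const _
  · refine Filter.Eventually.of_forall fun ω s _ => ?_
    have h1 : HasDerivAt (fun s : ℝ => ⟪x + s • v, (ω : E n)⟫) ⟪v, (ω : E n)⟫ s := by
      have : (fun s : ℝ => ⟪x + s • v, (ω : E n)⟫) = fun s : ℝ => ⟪x, (ω : E n)⟫ + s * ⟪v, (ω : E n)⟫ := by
        ext s; rw [inner_add_left, real_inner_smul_left]
      rw [this]
      simpa using ((hasDerivAt_id s).mul_const ⟪v, (ω : E n)⟫).const_add ⟪x, (ω : E n)⟫
    refine (h1.sin.const_mul ⟪v, (ω : E n)⟫).congr_deriv ?_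
    ring

/-- radial profile of the Fourier transform of surface measure and its derivatives -/
def jj (n : ℕ) (e : E n) (r : ℝ) : ℝ := ∫ ω, Real.cos ⟪r • e, (ω : E n)⟫ ∂(sg n)
def jj1 (n : ℕ) (e : E n) (r : ℝ) : ℝ := - ∫ ω, ⟪e, (ω : E n)⟫ * Real.sin ⟪r • e, (ω : E n)⟫ ∂(sg n)
def jj2 (n : ℕ) (e : E n) (r : ℝ) : ℝ := - ∫ ω, ⟪e, (ω : E n)⟫ ^ 2 * Real.cos ⟪r • e, (ω : E n)⟫ ∂(sg n)

lemma jj_deriv {n : ℕ} (e : E n) (r : ℝ) : HasDerivAt (jj n e) (jj1 n e r) r := by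
  have := deriv_cos 0 e r
  simp only [zero_add] at this
  exact this

lemma jj1_deriv {n : ℕ} (e : E n) (r : ℝ) : HasDerivAt (jj1 n e) (jj2 n e r) r := by
  have := (deriv_sin 0 e r).neg
  simp only [zero_add] at this
  exact this

lemma radial {n : ℕ} (e x : E n) (he : ‖e‖ = 1) :
    ∫ ω, Real.cos ⟪x, (ω : E n)⟫ ∂(sg n) = jj n e ‖x‖ := by
  have hn : ‖‖x‖ • e‖ = ‖x‖ := by rw [norm_smul, he]; simp
  set L := (ℝ ∙ ((‖x‖ • e) - x))ᗮ.reflection with hL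
  have h1 : L (‖x‖ • e) = x := Submodule.reflection_sub hn
  unfold jj
  have := integral_rot L (fun ω => Real.cos ⟪x, ω⟫) (by fun_prop)
  rw [← this]
  congr 1
  ext ω
  nth_rewrite 1 [← h1]
  rw [LinearIsometryEquiv.inner_map_map]

/-- second derivative kernel -/
def kk {n : ℕ} (v x : E n) : ℝ := ∫ ω, ⟪v, (ω : E n)⟫ ^ 2 * Real.cos ⟪x, (ω : E n)⟫ ∂(sg n)

lemma kk_formula {n : ℕ} (e x v : E n) (he : ‖e‖ = 1) (hv : ‖v‖ = 1) (hx : x ≠ 0) :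
    kk v x = - (jj2 n e ‖x‖ * (⟪x, v⟫ / ‖x‖) ^ 2 + jj1 n e ‖x‖ * (1 - (⟪x, v⟫ / ‖x‖) ^ 2) / ‖x‖) := by
  set r := ‖x‖ with hr
  have hr0 : 0 < r := norm_pos_iff.2 hx
  set b := ⟪x, v⟫ with hb
  have hN2 : ∀ s : ℝ, ‖x + s • v‖ ^ 2 = r ^ 2 + 2 * s * b + s ^ 2 := by
    intro s
    rw [norm_add_sq_real, real_inner_smul_right, norm_smul, hv]
    simp only [Real.norm_eq_abs, mul_one, sq_abs]
    ring
  have hev : ∀ᶠ s : ℝ in nhds 0, 0 < ‖x + s • v‖ := by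
    have hc : Continuous fun s : ℝ => ‖x + s • v‖ := by fun_prop
    have := hc.tendsto 0
    simp only [zero_smul, add_zero] at this
    exact this.eventually (lt_mem_nhds hr0)
  have hNd : ∀ s : ℝ, 0 < ‖x + s • v‖ → HasDerivAt (fun s : ℝ => ‖x + s • v‖) ((b + s) / ‖x + s • v‖) s := by
    intro s hs
    have h0 : (fun s : ℝ => ‖x + s • v‖) = fun s : ℝ => Real.sqrt (r ^ 2 + 2 * s * b + s ^ 2) := by
      ext s
      rw [← hN2, Real.sqrt_sq (norm_nonneg _)]
    have hpos : r ^ 2 + 2 * s * b + s ^ 2 ≠ 0 := by rw [← hN2]; positivity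
    have h1 : HasDerivAt (fun s : ℝ => r ^ 2 + 2 * s * b + s ^ 2) (2 * b + 2 * s) s := by
      have := (((hasDerivAt_id s).const_mul 2).mul_const b).const_add (r ^ 2) |>.add
        ((hasDerivAt_id s).pow 2)
      refine this.congr_deriv ?_
      simp
    have h2 := h1.sqrt hpos
    rw [← h0] at h2
    convert h2 using 1
    rw [← hN2, Real.sqrt_sq (norm_nonneg _)]
    field_simp
  -- first derivative
  have hd1 : ∀ᶠ s : ℝ in nhds 0, -∫ ω, ⟪v, (ω : E n)⟫ * Real.sin ⟪x + s • v, (ω : E n)⟫ ∂(sg n)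
      = jj1 n e ‖x + s • v‖ * ((b + s) / ‖x + s • v‖) := by
    filter_upwards [hev] with s hs
    have h1 := deriv_cos x v s
    have h2 := (jj_deriv e ‖x + s • v‖).comp s (hNd s hs)
    have h3 : (fun s : ℝ => ∫ ω, Real.cos ⟪x + s • v, (ω : E n)⟫ ∂(sg n)) = jj n e ∘ fun s : ℝ => ‖x + s • v‖ := by
      ext s; exact radial e _ he
    rw [h3] at h1
    exact h1.unique h2
  have h4 := (deriv_sin x v 0).neg
  have hN0 : HasDerivAt (fun s : ℝ => ‖x + s • v‖) (b / r) 0 := by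
    have := hNd 0 (by simpa using hx)
    simpa using this
  have h5a : HasDerivAt (fun s : ℝ => jj1 n e ‖x + s • v‖) (jj2 n e r * (b / r)) 0 := by
    have h6 : HasDerivAt (jj1 n e) (jj2 n e r) ((fun s : ℝ => ‖x + s • v‖) 0) := by
      simpa using jj1_deriv e r
    exact HasDerivAt.comp (h₂ := jj1 n e) (h := fun s : ℝ => ‖x + s • v‖) 0 h6 hN0
  have h5b : HasDerivAt (fun s : ℝ => (b + s) / ‖x + s • v‖) ((1 * r - b * (b / r)) / r ^ 2) 0 := by
    have := ((hasDerivAt_id (0:ℝ)).const_add b).div hN0 (by simpa using hx)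
    refine this.congr_deriv ?_
    simp [hr]
  have h5 := h5a.mul h5b
  have h7 := h4.congr_of_eventuallyEq (f₁ := fun s : ℝ => jj1 n e ‖x + s • v‖ * ((b + s) / ‖x + s • v‖)) (by
    filter_upwards [hd1] with s hs
    exact hs.symm)
  have h8 := h7.unique h5
  unfold kk
  simp only [zero_smul, add_zero] at h8
  rw [neg_eq_iff_eq_neg] at h8
  rw [h8]
  rw [← hr]
  field_simp

lemma jj_ode {n : ℕ} (e : E (n+1)) (he : ‖e‖ = 1) (r : ℝ) (hr : 0 < r) :
    jj2 (n+1) e r = - jj (n+1) e r - n * jj1 (n+1) e r / r := by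
  set x : E (n+1) := r • e with hx
  have hxn : ‖x‖ = r := by rw [hx, norm_smul, he]; simp [abs_of_pos hr]
  have hx0 : x ≠ 0 := by rw [← norm_pos_iff, hxn]; exact hr
  have h1 : jj (n+1) e r = ∑ i, kk (EuclideanSpace.single i (1:ℝ)) x := by
    unfold kk jj
    rw [← integral_finsetSum _ (fun i _ => integrable_sphere _ (by fun_prop))]
    congr 1
    ext ω
    rw [← Finset.sum_mul]
    have : ∑ i, ⟪EuclideanSpace.single i (1:ℝ), (ω : E (n+1))⟫ ^ 2 = 1 := by
      have h := EuclideanSpace.norm_sq_eq (ω : E (n+1))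
      simp at h
      simp_rw [EuclideanSpace.inner_single_left]
      simpa using h.symm
    rw [this, one_mul]
  have h2 : ∀ i, kk (EuclideanSpace.single i (1:ℝ)) x = - (jj2 (n+1) e r * (x i / r) ^ 2 + jj1 (n+1) e r * (1 - (x i / r) ^ 2) / r) := by
    intro i
    rw [kk_formula e x _ he (by simp) hx0, hxn, EuclideanSpace.inner_single_right]
    simp
  have h3 : ∑ i, (x i / r) ^ 2 = 1 := by
    have h := EuclideanSpace.norm_sq_eq x
    rw [hxn] at h
    simp only [div_pow]
    rw [← Finset.sum_div]
    simp at h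
    rw [← h]
    field_simp
  rw [h1]
  simp_rw [h2]
  have : ∀ i : Fin (n+1), -(jj2 (n+1) e r * (x i / r) ^ 2 + jj1 (n+1) e r * (1 - (x i / r) ^ 2) / r)
    = (jj1 (n+1) e r / r - jj2 (n+1) e r) * (x i / r) ^ 2 - jj1 (n+1) e r / r := by intro i; ring
  simp_rw [this]
  rw [Finset.sum_sub_distrib, ← Finset.mul_sum, h3]
  simp
  field_simp
  ring

/-- energy -/
lemma energy {n : ℕ} (e : E (n+1)) (he : ‖e‖ = 1) :
    ∃ C : ℝ, 0 ≤ C ∧ ∀ r : ℝ, 1 ≤ r → r ^ n * (jj (n+1) e r ^ 2 + (jj1 (n+1) e r + (n / 2 : ℝ) / r * jj (n+1) e r) ^ 2) ≤ C := by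
  set j := jj (n+1) e with hj
  set j1 := jj1 (n+1) e with hj1
  set m : ℝ := n / 2 with hm
  set c : ℝ := |m ^ 2 - m| with hc
  set g : ℝ → ℝ := fun r => j1 r + m / r * j r with hg
  set en : ℝ → ℝ := fun r => r ^ n * (j r ^ 2 + g r ^ 2) with hen
  have hder : ∀ r, 0 < r → HasDerivAt en (r ^ n * (2 * (m^2 - m) / r ^ 2 * (j r * g r))) r := by
    intro r hr
    have d1 : HasDerivAt j (j1 r) r := jj_deriv e r
    have d2 : HasDerivAt j1 (- j r - n * j1 r / r) r := by
      have := jj1_deriv e r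
      rw [jj_ode e he r hr] at this
      exact this
    have d3 : HasDerivAt (fun r : ℝ => m / r) (-m / r ^ 2) r := by
      have := (hasDerivAt_inv hr.ne').const_mul m
      simp only [div_eq_mul_inv]
      refine this.congr_deriv ?_
      ring
    have d4 : HasDerivAt g (- j r - n * j1 r / r + (-m / r ^ 2 * j r + m / r * j1 r)) r := d2.add (d3.mul d1)
    have d5 := (hasDerivAt_pow n r).mul ((d1.pow 2).add (d4.pow 2))
    refine d5.congr_deriv ?_
    have hn : (n : ℝ) = 2 * m := by rw [hm]; ring
    have hp : (n : ℝ) * r ^ (n - 1) = 2 * m / r * r ^ n := by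
      rcases Nat.eq_zero_or_pos n with h | h
      · subst h; simp [hm]
      · obtain ⟨k, rfl⟩ : ∃ k, n = k + 1 := ⟨n - 1, by omega⟩
        rw [hn, Nat.add_sub_cancel, pow_succ]
        field_simp
    rw [hp, hn]
    simp only [Pi.pow_apply, Pi.add_apply, hg]
    have hr1 : r ≠ 0 := hr.ne'
    field_simp
    ring_nf
    field_simp
    ring
  have hexp : ∀ r, 0 < r → HasDerivAt (fun r : ℝ => Real.exp (c / r)) (Real.exp (c / r) * (-c / r ^ 2)) r := by
    intro r hr
    have := (hasDerivAt_inv hr.ne').const_mul c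
    have h2 := this.exp
    simp only [div_eq_mul_inv]
    refine h2.congr_deriv ?_
    ring
  have hanti : AntitoneOn (fun r => en r * Real.exp (c / r)) (Set.Ici 1) := by
    apply antitoneOn_of_hasDerivWithinAt_nonpos (f' := fun r => r ^ n * (2 * (m^2 - m) / r ^ 2 * (j r * g r)) * Real.exp (c / r) + en r * (Real.exp (c / r) * (-c / r ^ 2))) (convex_Ici 1)
    · intro r hr
      have hr0 : 0 < r := lt_of_lt_of_le one_pos hr
      exact ((hder r hr0).mul (hexp r hr0)).continuousAt.continuousWithinAt
    · intro r hr
      rw [interior_Ici] at hr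
      have hr0 : 0 < r := lt_trans one_pos hr
      exact ((hder r hr0).mul (hexp r hr0)).hasDerivWithinAt
    · intro r hr
      rw [interior_Ici] at hr
      have hr0 : 0 < r := lt_trans one_pos hr
      have : r ^ n * (2 * (m^2 - m) / r ^ 2 * (j r * g r)) * Real.exp (c / r) + en r * (Real.exp (c / r) * (-c / r ^ 2)) = (r ^ n * Real.exp (c / r) / r ^ 2) * ((m ^ 2 - m) * (2 * (j r * g r)) - c * (j r ^ 2 + g r ^ 2)) := by
        simp only [hen]; field_simp; ring
      rw [this]
      apply mul_nonpos_of_nonneg_of_nonpos (by positivity)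
      have h1 : |2 * (j r * g r)| ≤ j r ^ 2 + g r ^ 2 := by
        rw [abs_le]; constructor <;> nlinarith [sq_nonneg (j r + g r), sq_nonneg (j r - g r)]
      have h2 : (m ^ 2 - m) * (2 * (j r * g r)) ≤ c * (j r ^ 2 + g r ^ 2) := by
        calc _ ≤ |(m ^ 2 - m) * (2 * (j r * g r))| := le_abs_self _
          _ = c * |2 * (j r * g r)| := abs_mul _ _
          _ ≤ _ := by gcongr
      linarith
  refine ⟨en 1 * Real.exp (c / 1), by positivity, fun r hr => ?_⟩
  have h1 := hanti (Set.self_mem_Ici) hr hr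
  simp only at h1
  have h2 : 0 ≤ en r := by simp only [hen]; positivity
  calc _ = en r * 1 := by simp [hen, hg]
    _ ≤ en r * Real.exp (c / r) := by gcongr; exact Real.one_le_exp (by positivity)
    _ ≤ _ := h1

lemma kk_decay (n : ℕ) : ∃ C : ℝ, 0 < C ∧ ∀ v x : E (n+1), ‖v‖ = 1 → 1 ≤ ‖x‖ →
    |kk v x| ≤ C * ‖x‖ ^ (-(n / 2 : ℝ)) := by
  set e : E (n+1) := EuclideanSpace.single 0 1
  have he : ‖e‖ = 1 := by simp [e]
  obtain ⟨C, hC, hE⟩ := energy e he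
  set m : ℝ := n / 2 with hm
  have hm0 : 0 ≤ m := by positivity
  set D := Real.sqrt C with hD
  have hD0 : 0 ≤ D := Real.sqrt_nonneg _
  refine ⟨D + (n + 1) * (D + m * D) + 1, by positivity, fun v x hv hx => ?_⟩
  set r := ‖x‖ with hr
  have hr0 : 0 < r := by linarith
  set ρ := r ^ (-m) with hρ
  have hρ0 : 0 < ρ := by positivity
  have hρ2 : r ^ n * ρ ^ 2 = 1 := by
    rw [hρ, ← Real.rpow_natCast, ← Real.rpow_natCast, ← Real.rpow_mul hr0.le, ← Real.rpow_add hr0]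
    have : (n : ℝ) + -m * (2:ℕ) = 0 := by rw [hm]; push_cast; ring
    rw [this, Real.rpow_zero]
  have key := hE r hx
  set g := jj1 (n+1) e r + m / r * jj (n+1) e r with hg
  have hb : jj (n+1) e r ^ 2 + g ^ 2 ≤ (D * ρ) ^ 2 := by
    rw [mul_pow, Real.sq_sqrt hC]
    calc jj (n+1) e r ^ 2 + g ^ 2 = (r ^ n * (jj (n+1) e r ^ 2 + g ^ 2)) * ρ ^ 2 := by
          rw [mul_right_comm, hρ2, one_mul]
      _ ≤ C * ρ ^ 2 := by gcongr
  have hj : |jj (n+1) e r| ≤ D * ρ := by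
    apply abs_le_of_sq_le_sq _ (by positivity)
    nlinarith [sq_nonneg g]
  have hgb : |g| ≤ D * ρ := by
    apply abs_le_of_sq_le_sq _ (by positivity)
    nlinarith [sq_nonneg (jj (n+1) e r)]
  have hinv : 1 / r ≤ 1 := by rw [div_le_one hr0]; exact hx
  have hj1 : |jj1 (n+1) e r| ≤ (D + m * D) * ρ := by
    have : jj1 (n+1) e r = g - m * (1 / r) * jj (n+1) e r := by rw [hg]; ring
    rw [this]
    calc _ ≤ |g| + |m * (1 / r) * jj (n+1) e r| := abs_sub _ _
      _ = |g| + m * (1 / r) * |jj (n+1) e r| := by rw [abs_mul, abs_of_nonneg (by positivity : 0 ≤ m * (1/r))]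
      _ ≤ D * ρ + m * 1 * (D * ρ) := by gcongr
      _ = _ := by ring
  have hj2 : |jj2 (n+1) e r| ≤ (D + n * (D + m * D)) * ρ := by
    have : jj2 (n+1) e r = - jj (n+1) e r - (n * (1 / r)) * jj1 (n+1) e r := by rw [jj_ode e he r hr0]; ring
    rw [this]
    calc _ ≤ |-jj (n+1) e r| + |(n * (1 / r)) * jj1 (n+1) e r| := abs_sub _ _
      _ = |jj (n+1) e r| + n * (1 / r) * |jj1 (n+1) e r| := by
        rw [abs_neg, abs_mul, abs_of_nonneg (by positivity : 0 ≤ (n:ℝ) * (1/r))]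
      _ ≤ D * ρ + n * 1 * ((D + m * D) * ρ) := by gcongr
      _ = _ := by ring
  rw [kk_formula e x v he hv (norm_pos_iff.1 (by rw [← hr]; exact hr0)), abs_neg, ← hr]
  set b := (⟪x, v⟫ / r) ^ 2 with hb'
  have hb0 : 0 ≤ b := by positivity
  have hb1 : b ≤ 1 := by
    have := abs_real_inner_le_norm x v
    rw [hv, mul_one, ← hr] at this
    rw [hb', div_pow, div_le_one (by positivity)]
    exact sq_le_sq' (by linarith [neg_abs_le ⟪x, v⟫]) (by linarith [le_abs_self ⟪x, v⟫])
  calc |jj2 (n+1) e r * b + jj1 (n+1) e r * (1 - b) / r|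
      ≤ |jj2 (n+1) e r * b| + |jj1 (n+1) e r * (1 - b) / r| := abs_add_le _ _
    _ = |jj2 (n+1) e r| * b + |jj1 (n+1) e r| * (1 - b) * (1 / r) := by
        rw [abs_mul, abs_div, abs_mul, abs_of_nonneg hb0, abs_of_nonneg (by linarith : 0 ≤ 1 - b), abs_of_pos hr0]; ring
    _ ≤ ((D + n * (D + m * D)) * ρ) * 1 + ((D + m * D) * ρ) * 1 * 1 := by
        gcongr
        linarith
    _ ≤ _ := by nlinarith

end ST

namespace ST

/-- drop a coordinate -/
def pr {n : ℕ} (i : Fin (n+1)) (x : E (n+1)) : E n := WithLp.toLp 2 (fun j => x (i.succAbove j))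

/-- split off a coordinate -/
def sl {n : ℕ} (i : Fin (n+1)) : E (n+1) ≃ᵐ ℝ × E n :=
  ((MeasurableEquiv.toLp 2 (Fin (n+1) → ℝ)).symm.trans
    (MeasurableEquiv.piFinSuccAbove (fun _ => ℝ) i)).trans
    (MeasurableEquiv.prodCongr (MeasurableEquiv.refl ℝ) (MeasurableEquiv.toLp 2 (Fin n → ℝ)))

lemma sl_apply {n : ℕ} (i : Fin (n+1)) (x : E (n+1)) : sl i x = (x i, pr i x) := rfl

lemma sl_symm_i {n : ℕ} (i : Fin (n+1)) (z : ℝ × E n) : (sl i).symm z i = z.1 := by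
  have := (sl i).apply_symm_apply z
  rw [sl_apply] at this
  exact congrArg Prod.fst this

lemma sl_symm_pr {n : ℕ} (i : Fin (n+1)) (z : ℝ × E n) : pr i ((sl i).symm z) = z.2 := by
  have := (sl i).apply_symm_apply z
  rw [sl_apply] at this
  exact congrArg Prod.snd this

lemma sl_mp {n : ℕ} (i : Fin (n+1)) : MeasurePreserving (sl i) volume volume := by
  unfold sl
  refine MeasurePreserving.trans (MeasurePreserving.trans
    (EuclideanSpace.volume_preserving_symm_measurableEquiv_toLp (Fin (n+1)))
    (volume_preserving_piFinSuccAbove (fun _ => ℝ) i)) ?_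
  exact (MeasurePreserving.id _).prod (PiLp.volume_preserving_toLp (Fin n))

lemma inner_split {n : ℕ} (i : Fin (n+1)) (x y : E (n+1)) : ⟪x, y⟫ = x i * y i + ⟪pr i x, pr i y⟫ := by
  simp only [PiLp.inner_apply, pr]
  rw [Fin.sum_univ_succAbove _ i]
  simp [mul_comm]

lemma norm_split {n : ℕ} (i : Fin (n+1)) (x : E (n+1)) : ‖x‖ ^ 2 = x i ^ 2 + ‖pr i x‖ ^ 2 := by
  rw [← real_inner_self_eq_norm_sq, ← real_inner_self_eq_norm_sq, inner_split i]; ring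

lemma pr_cont {n : ℕ} (i : Fin (n+1)) : Continuous (pr i) := by
  unfold pr; fun_prop

lemma pr_smul {n : ℕ} (i : Fin (n+1)) (c : ℝ) (x : E (n+1)) : pr i (c • x) = c • pr i x := rfl

/-- central-type projection -/
lemma proj_cov {n : ℕ} (s : ℝ) (hs0 : s ≠ 0) (hs1 : |s| < 1) (F : E n → ℝ≥0∞) :
    ∫⁻ y : E n, ENNReal.ofReal ((|s| / √(s ^ 2 + ‖y‖ ^ 2)) ^ (n + 3)) * F ((√(s ^ 2 + ‖y‖ ^ 2))⁻¹ • y)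
      ≤ ∫⁻ y : E n, F y := by
  set N : E n → ℝ := fun y => √(s ^ 2 + ‖y‖ ^ 2) with hN
  have hs2 : 0 < s ^ 2 := by positivity
  have hNpos : ∀ y, 0 < N y := fun y => Real.sqrt_pos.2 (by positivity)
  have hNsq : ∀ y, N y ^ 2 = s ^ 2 + ‖y‖ ^ 2 := fun y => Real.sq_sqrt (by positivity)
  set φ : E n → E n := fun y => (N y)⁻¹ • y with hφ
  set φ' : E n → (E n →L[ℝ] E n) := fun y =>
    (N y)⁻¹ • ContinuousLinearMap.id ℝ (E n) + (-((N y)⁻¹ ^ 3) • innerSL ℝ y).smulRight y with hφ'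
  have hder : ∀ y, HasFDerivAt φ (φ' y) y := by
    intro y
    have h1 : HasFDerivAt (fun y : E n => s ^ 2 + ‖y‖ ^ 2) (2 • innerSL ℝ y) y :=
      (hasStrictFDerivAt_norm_sq y).hasFDerivAt.const_add (s ^ 2)
    have h2 : HasFDerivAt N _ y := h1.sqrt (by positivity)
    have h3 := (hasDerivAt_inv (hNpos y).ne').comp_hasFDerivAt y h2
    have h4 := h3.smul (hasFDerivAt_id y)
    refine h4.congr_fderiv ?_
    ext1 v
    simp only [hφ']
    have hN' : √(s ^ 2 + ‖y‖ ^ 2) = N y := rfl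
    simp only [hN', Function.comp, _root_.add_apply, _root_.smul_apply,
      ContinuousLinearMap.smulRight_apply, ContinuousLinearMap.id_apply, id]
    congr 1
    congr 1
    simp only [smul_eq_mul, nsmul_eq_mul]
    have := (hNpos y).ne'
    field_simp
    norm_num
  have hinj : Function.Injective φ := by
    intro y z h
    have hn : ‖φ y‖ ^ 2 = ‖φ z‖ ^ 2 := by rw [h]
    have hval : ∀ y, ‖φ y‖ ^ 2 = 1 - s ^ 2 / N y ^ 2 := by
      intro y
      rw [hφ]
      simp only [norm_smul, norm_inv, Real.norm_eq_abs, mul_pow, abs_of_pos (hNpos y)]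
      have := (hNpos y).ne'
      have := hNsq y
      field_simp
      linarith
    rw [hval, hval] at hn
    have h1 : s ^ 2 / N y ^ 2 = s ^ 2 / N z ^ 2 := by linarith
    have h2 : N y ^ 2 = N z ^ 2 := by
      have ha := hNpos y
      have hb := hNpos z
      field_simp at h1
      linarith
    have h3 : N y = N z := by
      have ha := hNpos y
      have hb := hNpos z
      nlinarith
    simp only [hφ, h3] at h
    exact smul_right_injective _ (inv_ne_zero (hNpos z).ne') h
  have hdet : ∀ y, (φ' y).det = (N y)⁻¹ ^ n * (s ^ 2 / N y ^ 2) := by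
    intro y
    have h1 : ((φ' y : E n →L[ℝ] E n) : E n →ₗ[ℝ] E n) = (N y)⁻¹ •
        LinearMap.transvection ((-((N y)⁻¹ ^ 2)) • (innerSL ℝ y : E n →L[ℝ] ℝ).toLinearMap) y := by
      ext1 v
      simp [hφ', LinearMap.transvection, smul_smul, pow_succ]
      ring_nf
    rw [ContinuousLinearMap.det, h1, LinearMap.det_smul, LinearMap.transvection.det]
    have h0 := (hNpos y).ne'
    have h2 := hNsq y
    simp
    left
    field_simp
    rw [h2]; ring
  have hcov := lintegral_image_eq_lintegral_abs_det_fderiv_mul (volume : Measure (E n)) MeasurableSet.univ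
    (fun y _ => (hder y).hasFDerivWithinAt) hinj.injOn F
  calc _ ≤ ∫⁻ y : E n, ENNReal.ofReal |(φ' y).det| * F (φ y) := by
        refine lintegral_mono fun y => ?_
        simp only
        gcongr
        rw [hdet]
        have hpos := hNpos y
        have hsN : |s| ≤ N y := by
          rw [← Real.sqrt_sq_eq_abs]
          exact Real.sqrt_le_sqrt (by nlinarith [sq_nonneg ‖y‖])
        change (|s| / N y) ^ (n+3) ≤ _
        rw [abs_of_nonneg (a := (N y)⁻¹ ^ n * (s ^ 2 / N y ^ 2)) (by positivity)]
        have e1 : (|s| / N y) ^ (n+3) = ((N y)⁻¹ ^ n * (s ^ 2 / N y ^ 2)) * (|s| ^ n * (|s| / N y)) := by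
          rw [pow_add, pow_succ (|s| / N y) 2, div_pow _ _ 2, sq_abs, div_pow, inv_pow]
          field_simp
        rw [e1]
        apply mul_le_of_le_one_right (by positivity)
        have : |s| / N y ≤ 1 := by rw [div_le_one hpos]; exact hsN
        have h3 : |s| ^ n ≤ 1 := pow_le_one₀ (abs_nonneg _) hs1.le
        have h4 : 0 ≤ |s| / N y := by positivity
        calc _ ≤ (1:ℝ) * 1 := mul_le_mul h3 this h4 zero_le_one
          _ = 1 := one_mul 1
    _ = ∫⁻ y in φ '' Set.univ, F y := by rw [hcov]; simp
    _ ≤ _ := setLIntegral_le_lintegral _ _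

/-- polar coordinates for lintegral -/
lemma polar {n : ℕ} (H : E (n+1) → ℝ≥0∞) (hH : Measurable H) :
    ∫⁻ x, H x = ∫⁻ ω, ∫⁻ r : Set.Ioi (0:ℝ), H (r.1 • (ω : E (n+1))) ∂(Measure.volumeIoiPow n) ∂(sg (n+1)) := by
  have h1 : ∫⁻ x, H x = ∫⁻ x : ({(0 : E (n+1))}ᶜ : Set (E (n+1))), H x ∂((volume : Measure (E (n+1))).comap (↑)) := by
    rw [lintegral_subtype_comap (measurableSet_singleton _).compl, restrict_compl_singleton]
  have h2 := (volume : Measure (E (n+1))).measurePreserving_homeomorphUnitSphereProd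
  rw [finrank_euclideanSpace_fin, Nat.add_sub_cancel] at h2
  have h3 := h2.lintegral_comp (f := fun p : sphere (0 : E (n+1)) 1 × Set.Ioi (0:ℝ) => H (p.2.1 • (p.1 : E (n+1)))) (by fun_prop)
  rw [lintegral_prod _ (by fun_prop)] at h3
  rw [h1, ← h3]
  congr 1
  ext x
  congr 1
  have hx : ‖(x : E (n+1))‖ ≠ 0 := norm_ne_zero_iff.2 x.2
  simp [smul_smul, hx]

lemma push {n : ℕ} (i : Fin (n+1)) (F : E n → ℝ≥0∞) (hF : Measurable F) :
    ∫⁻ ω, ENNReal.ofReal ((ω : E (n+1)) i ^ 2) * F (pr i (ω : E (n+1))) ∂(sg (n+1))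
      ≤ (2 * (n + 1)) * ∫⁻ y, F y := by
  have hprm : Measurable (pr i) := (pr_cont i).measurable
  have him : Measurable (fun x : E (n+1) => x i) := by fun_prop
  set H : E (n+1) → ℝ≥0∞ := {x : E (n+1) | |x i| < 1}.indicator (fun x =>
    ENNReal.ofReal ((|x i| / ‖x‖) ^ (n+3)) * F (pr i (‖x‖⁻¹ • x))) with hH
  have hHm : Measurable H := by
    refine Measurable.indicator ?_ (measurableSet_lt (by fun_prop) measurable_const)
    refine Measurable.mul (by fun_prop) (hF.comp (hprm.comp (by fun_prop)))
  have hA : ∫⁻ ω, ENNReal.ofReal ((ω : E (n+1)) i ^ 2) * F (pr i (ω : E (n+1))) ∂(sg (n+1))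
      ≤ (n + 1) * ∫⁻ x, H x := by
    rw [polar H hHm, ← lintegral_const_mul' _ _ (by finiteness)]
    refine lintegral_mono fun ω => ?_
    simp only
    set a := |(ω : E (n+1)) i| with ha
    rcases eq_or_ne ((ω : E (n+1)) i) 0 with h0 | h0
    · simp [h0]
    have ha0 : 0 < a := abs_pos.2 h0
    have h1 : ∀ r : Set.Ioi (0:ℝ), H (r.1 • (ω : E (n+1))) =
        (Set.Iio (⟨1 / a, by simp; exact ha0⟩ : Set.Ioi (0:ℝ))).indicator (fun _ => ENNReal.ofReal (a ^ (n+3)) * F (pr i (ω : E (n+1)))) r := by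
      intro r
      have hr : 0 < r.1 := r.2
      have hω : ‖(ω : E (n+1))‖ = 1 := by simp
      have hiff : (r.1 • (ω : E (n+1)) ∈ {x : E (n+1) | |x i| < 1}) ↔ r ∈ (Set.Iio (⟨1 / a, by simp; exact ha0⟩ : Set.Ioi (0:ℝ))) := by
        simp only [Set.mem_ofPred_eq, PiLp.smul_apply, smul_eq_mul, abs_mul, abs_of_pos hr, Set.mem_Iio, ← Subtype.coe_lt_coe]
        rw [lt_div_iff₀ ha0]
      have hnorm : ‖r.1 • (ω : E (n+1))‖ = r.1 := by rw [norm_smul, hω]; simp [abs_of_pos hr]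
      rw [hH]
      simp only [Set.indicator_apply, hiff]
      congr 1
      rw [hnorm, smul_smul, inv_mul_cancel₀ hr.ne', one_smul]
      congr 3
      simp only [PiLp.smul_apply, smul_eq_mul, abs_mul, abs_of_pos hr]
      field_simp
      rfl
    simp_rw [h1]
    rw [lintegral_indicator measurableSet_Iio, setLIntegral_const, Measure.volumeIoiPow_apply_Iio]
    have h2 : (n + 1 : ℝ≥0∞) = ENNReal.ofReal (n + 1) := by
      rw [ENNReal.ofReal_add (by positivity) (by positivity)]; simp
    rw [h2]
    have h3 : ENNReal.ofReal (n+1) * (ENNReal.ofReal (a ^ (n+3)) * F (pr i (ω : E (n+1))) * ENNReal.ofReal ((1 / a) ^ (n+1) / (n+1)))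
        = (ENNReal.ofReal (n+1) * ENNReal.ofReal (a ^ (n+3)) * ENNReal.ofReal ((1 / a) ^ (n+1) / (n+1))) * F (pr i (ω : E (n+1))) := by ring
    rw [h3, ← ENNReal.ofReal_mul (by positivity), ← ENNReal.ofReal_mul (by positivity)]
    gcongr
    apply le_of_eq
    rw [← sq_abs, ← ha]
    have : (n + 1 : ℝ) ≠ 0 := by positivity
    rw [one_div, inv_pow]
    field_simp
    ring
  refine hA.trans ?_
  have hB : ∫⁻ x, H x ≤ 2 * ∫⁻ y, F y := by
    have h1 := (sl_mp i).symm.lintegral_comp_emb (sl i).symm.measurableEmbedding H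
    rw [← h1]
    rw [Measure.volume_eq_prod, lintegral_prod _ (by
      exact (hHm.comp (sl i).symm.measurable).aemeasurable)]
    calc ∫⁻ s : ℝ, ∫⁻ y : E n, H ((sl i).symm (s, y)) ≤ ∫⁻ s : ℝ, (Set.Ioo (-1:ℝ) 1).indicator (fun _ => ∫⁻ y, F y) s := by
          refine lintegral_mono_ae ?_
          have hne : ∀ᵐ s : ℝ, s ≠ 0 := by
            rw [ae_iff]; simp
          filter_upwards [hne] with s hs
          by_cases hs1 : |s| < 1
          · have : s ∈ Set.Ioo (-1:ℝ) 1 := abs_lt.1 hs1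
            rw [Set.indicator_of_mem this]
            refine le_trans (le_of_eq ?_) (proj_cov s hs hs1 F)
            congr 1
            ext y
            have hn : ‖(sl i).symm (s, y)‖ = √(s ^ 2 + ‖y‖ ^ 2) := by
              rw [← Real.sqrt_sq (norm_nonneg ((sl i).symm (s, y))), norm_split i, sl_symm_i, sl_symm_pr]
            have hmem : (sl i).symm (s, y) ∈ {x : E (n+1) | |x i| < 1} := by
              simp only [Set.mem_ofPred_eq, sl_symm_i]; exact hs1
            rw [hH, Set.indicator_of_mem hmem, pr_smul, hn, sl_symm_i, sl_symm_pr]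
          · have : s ∉ Set.Ioo (-1:ℝ) 1 := fun h => hs1 (abs_lt.2 h)
            rw [Set.indicator_of_notMem this]
            apply le_of_eq
            refine lintegral_eq_zero_of_ae_eq_zero (Filter.Eventually.of_forall fun y => ?_)
            have hmem : (sl i).symm (s, y) ∉ {x : E (n+1) | |x i| < 1} := by
              simp only [Set.mem_ofPred_eq, sl_symm_i]; exact hs1
            change H ((sl i).symm (s, y)) = 0
            rw [hH, Set.indicator_of_notMem hmem]
      _ = _ := by
          rw [lintegral_indicator measurableSet_Ioo, setLIntegral_const, Real.volume_Ioo, mul_comm]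
          congr 1
          norm_num
  calc (n + 1 : ℝ≥0∞) * ∫⁻ x, H x ≤ (n+1) * (2 * ∫⁻ y, F y) := by gcongr
    _ = _ := by ring

end ST

namespace ST
open scoped FourierTransform SchwartzMap ContDiff

lemma fourierTf_eq {n : ℕ} (u : E n → ℂ) (ξ : E n) :
    fourierTf u ξ = 𝓕 u ((2 * Real.pi)⁻¹ • ξ) := by
  rw [Real.fourier_eq', fourierTf]
  congr 1
  ext x
  rw [inner_smul_right, smul_eq_mul]
  congr 2
  push_cast
  have : (Real.pi : ℂ) ≠ 0 := by exact_mod_cast Real.pi_ne_zero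
  field_simp

lemma continuous_fourier {n : ℕ} {u : E n → ℂ} (hu : Integrable u) : Continuous (𝓕 u) :=
  VectorFourier.fourierIntegral_continuous Real.continuous_fourierChar continuous_inner hu

lemma fourierTf_cont {n : ℕ} {u : E n → ℂ} (hu : Integrable u) : Continuous (fourierTf u) := by
  have : fourierTf u = fun ξ => 𝓕 u ((2 * Real.pi)⁻¹ • ξ) := funext (fourierTf_eq u)
  rw [this]
  exact (continuous_fourier hu).comp (continuous_const_smul _)

lemma fourierTf_bound {n : ℕ} (u : E n → ℂ) (ξ : E n) : ‖fourierTf u ξ‖ ≤ ∫ x, ‖u x‖ := by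
  rw [fourierTf]
  refine (norm_integral_le_integral_norm _).trans (le_of_eq ?_)
  congr 1
  ext x
  rw [norm_mul, Complex.norm_exp]
  simp

lemma planch0 {n : ℕ} {u : E n → ℂ} (hu : Integrable u) (hu2 : MemLp u 2) :
    ∫⁻ ξ, ‖𝓕 u ξ‖ₑ ^ 2 = ∫⁻ x, ‖u x‖ₑ ^ 2 := by
  set U : Lp ℂ 2 (volume : Measure (E n)) := hu2.toLp u
  have key : ∀ᵐ ξ : E n, 𝓕 u ξ = (𝓕 U : Lp ℂ 2 (volume : Measure (E n))) ξ := by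
    apply ae_eq_of_integral_contDiff_smul_eq
    · exact (continuous_fourier hu).locallyIntegrable
    · exact (Lp.memLp _).locallyIntegrable (by norm_num)
    · intro g hg hgc
      have hgc' : HasCompactSupport (fun x => (g x : ℂ)) := hgc.comp_left (g := fun t : ℝ => (t:ℂ)) (by simp)
      have hg' : ContDiff ℝ ∞ (fun x => (g x : ℂ)) := Complex.ofRealCLM.contDiff.comp hg
      set G : 𝓢(E n, ℂ) := hgc'.toSchwartzMap hg' with hG
      have hGa : ∀ x, G x = (g x : ℂ) := fun x => rfl
      have h1 := congrArg (fun T => T G) (Lp.fourier_toTemperedDistribution_eq U)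
      simp only [TemperedDistribution.fourier_apply, Lp.toTemperedDistribution_apply] at h1
      have h2 : ∫ x, (𝓕 G) x • U x = ∫ x, (𝓕 G) x • u x := by
        apply integral_congr_ae
        filter_upwards [hu2.coeFn_toLp] with x hx
        rw [hx]
      have h3 : ∫ x, (𝓕 (G : E n → ℂ)) x • u x = ∫ x, (G x) • 𝓕 u x := by
        simpa using! VectorFourier.integral_fourierIntegral_smul_eq_flip (L := innerₗ (E n))
          Real.continuous_fourierChar continuous_inner G.integrable hu
      rw [SchwartzMap.fourier_coe] at h2
      rw [SchwartzMap.fourier_coe, h2, h3] at h1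
      simpa [hGa] using h1
  have e1 : eLpNorm (𝓕 u) 2 volume = eLpNorm u 2 volume := by
    rw [eLpNorm_congr_ae key]
    have h4 := Lp.norm_fourier_eq U
    rw [Lp.norm_def, Lp.norm_def] at h4
    rw [ENNReal.toReal_eq_toReal_iff' (Lp.eLpNorm_ne_top _) (Lp.eLpNorm_ne_top _)] at h4
    rw [h4]
    exact eLpNorm_congr_ae hu2.coeFn_toLp
  rw [eLpNorm_eq_lintegral_rpow_enorm_toReal (by norm_num) (by norm_num),
    eLpNorm_eq_lintegral_rpow_enorm_toReal (by norm_num) (by norm_num)] at e1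
  have e2 := congrArg (fun t : ℝ≥0∞ => t ^ (2:ℝ)) e1
  simp only [← ENNReal.rpow_mul] at e2
  norm_num at e2
  simpa using e2

lemma lintegral_dil {n : ℕ} (F : E n → ℝ≥0∞) (r : ℝ) (hr : 0 < r) :
    ∫⁻ x, F (r⁻¹ • x) = ENNReal.ofReal (r ^ n) * ∫⁻ x, F x := by
  have hr' : r⁻¹ ≠ 0 := (inv_pos.2 hr).ne'
  have h := Measure.map_addHaar_smul (volume : Measure (E n)) hr'
  have h2 : ∫⁻ x, F x ∂(Measure.map (r⁻¹ • ·) (volume : Measure (E n))) = ∫⁻ x, F (r⁻¹ • x) :=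
    (Homeomorph.smulOfNeZero r⁻¹ hr').measurableEmbedding.lintegral_map F
  rw [← h2, h, lintegral_smul_measure, smul_eq_mul]
  congr 2
  simp [abs_of_pos hr]

lemma planch {n : ℕ} {u : E n → ℂ} (hu : Integrable u) (hu2 : MemLp u 2) :
    ∫⁻ ξ, ‖fourierTf u ξ‖ₑ ^ 2 = ENNReal.ofReal ((2 * Real.pi) ^ n) * ∫⁻ x, ‖u x‖ₑ ^ 2 := by
  rw [← planch0 hu hu2]
  simp_rw [fourierTf_eq]
  exact lintegral_dil (fun ξ => ‖𝓕 u ξ‖ₑ ^ 2) _ (by positivity)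

end ST

namespace ST

abbrev Sp (n : ℕ) := sphere (0 : E n) 1

lemma fub {n m : ℕ} (c : Sp m × E n → ℂ) (hc : Continuous c) (K : ℝ)
    (hb : ∀ p, ‖c p‖ ≤ K) {u : E n → ℂ} (hu : Integrable u) :
    Integrable (fun p : Sp m × E n => c p * u p.2) ((sg m).prod volume) :=
  (hu.comp_snd (sg m)).bdd_mul (c := K) hc.aestronglyMeasurable (Filter.Eventually.of_forall hb)

/-- slice operator -/
def TT {n : ℕ} (i : Fin (n+1)) (τ : ℝ) (u : E n → ℂ) (y : E n) : ℂ :=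
  ∫ ω : Sp (n+1), ((((ω : E (n+1)) i ^ 2 : ℝ) : ℂ) * Complex.exp ((τ * (ω : E (n+1)) i + ⟪y, pr i ω⟫ : ℝ) * I))
    * fourierTf u (pr i ω) ∂sg (n+1)

lemma abs_coord_le {n : ℕ} (i : Fin n) (ω : Sp n) : |(ω : E n) i| ≤ 1 := by
  have h1 : ‖(ω : E n)‖ = 1 := by simp
  have := PiLp.norm_apply_le (ω : E n) i
  rw [h1] at this
  simpa using this

lemma norm_wt {n : ℕ} (i : Fin n) (ω : Sp n) (θ : ℝ) :
    ‖((((ω : E n) i ^ 2 : ℝ) : ℂ) * Complex.exp (θ * I))‖ ≤ 1 := by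
  rw [norm_mul, Complex.norm_exp_ofReal_mul_I, mul_one, Complex.norm_real, Real.norm_eq_abs, abs_pow]
  exact pow_le_one₀ (abs_nonneg _) (abs_coord_le i ω)

@[fun_prop]
lemma cont_coord {n : ℕ} (i : Fin n) : Continuous (fun ω : Sp n => (ω : E n) i) := by
  fun_prop

lemma kker {n : ℕ} (i : Fin n) (x : E n) :
    ∫ ω : Sp n, ((((ω : E n) i ^ 2 : ℝ) : ℂ) * Complex.exp ((⟪x, ω⟫ : ℝ) * I)) ∂sg n
      = ((kk (EuclideanSpace.single i 1) x : ℝ) : ℂ) := by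
  have h0 : ∫ ω : Sp n, (ω : E n) i ^ 2 * Real.sin ⟪x, ω⟫ ∂sg n = 0 := by
    have h := integral_rot (LinearIsometryEquiv.neg ℝ (E := E n))
      (fun w => w i ^ 2 * Real.sin ⟪x, w⟫) (by fun_prop)
    simp only [LinearIsometryEquiv.coe_neg, inner_neg_right, Real.sin_neg, mul_neg,
      PiLp.neg_apply, even_two, Even.neg_pow, integral_neg] at h
    linarith
  have h1 : Integrable (fun ω : Sp n => (((ω : E n) i ^ 2 * Real.cos ⟪x, ω⟫ : ℝ) : ℂ)) (sg n) :=
    integrable_sphere _ (by fun_prop)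
  have h2 : Integrable (fun ω : Sp n => (((ω : E n) i ^ 2 * Real.sin ⟪x, ω⟫ : ℝ) : ℂ) * I) (sg n) :=
    integrable_sphere _ (by fun_prop)
  calc _ = ∫ ω : Sp n, ((((ω : E n) i ^ 2 * Real.cos ⟪x, ω⟫ : ℝ) : ℂ) +
          (((ω : E n) i ^ 2 * Real.sin ⟪x, ω⟫ : ℝ) : ℂ) * I) ∂sg n := by
        congr 1
        ext ω
        rw [Complex.exp_mul_I]
        push_cast
        ring
    _ = _ := by
        rw [integral_add h1 h2, integral_mul_const, integral_complex_ofReal, integral_complex_ofReal, h0, kk]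
        simp [EuclideanSpace.inner_single_left]

lemma TT_fub {n : ℕ} (i : Fin (n+1)) (τ : ℝ) {u : E n → ℂ} (hu : Integrable u) (y : E n) :
    TT i τ u y = ∫ x, ((kk (EuclideanSpace.single i 1) ((sl i).symm (τ, y - x)) : ℝ) : ℂ) * u x := by
  have hc := fub (n := n) (m := n+1)
    (fun p => (((p.1 : E (n+1)) i ^ 2 : ℝ) : ℂ) *
      Complex.exp ((τ * (p.1 : E (n+1)) i + ⟪y - p.2, pr i p.1⟫ : ℝ) * I)) (by
      have := pr_cont (n := n) i
      fun_prop) 1 (fun p => norm_wt i p.1 _) hu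
  have hsw := integral_integral_swap (f := fun (ω : Sp (n+1)) (x : E n) =>
    ((((ω : E (n+1)) i ^ 2 : ℝ) : ℂ) *
      Complex.exp ((τ * (ω : E (n+1)) i + ⟪y - x, pr i ω⟫ : ℝ) * I)) * u x) hc
  rw [TT]
  refine Eq.trans (Eq.trans ?_ hsw) ?_
  · congr 1
    ext ω
    rw [fourierTf, ← integral_const_mul]
    congr 1
    ext x
    rw [← mul_assoc, mul_assoc _ (cexp _) (cexp _), ← Complex.exp_add]
    congr 3
    rw [inner_sub_left]
    push_cast
    ring
  · congr 1
    ext x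
    rw [integral_mul_const, ← kker]
    congr 2
    ext ω
    rw [inner_split i, sl_symm_i, sl_symm_pr]

lemma kk_bound {n : ℕ} (i : Fin n) (x : E n) :
    |kk (EuclideanSpace.single i 1) x| ≤ (sg n).real Set.univ := by
  rw [kk, ← Real.norm_eq_abs]
  refine (norm_integral_le_of_norm_le_const (C := 1) (Filter.Eventually.of_forall fun ω => ?_)).trans (by simp)
  rw [EuclideanSpace.inner_single_left, norm_mul, norm_pow]
  simp only [map_one, one_mul, Real.norm_eq_abs]
  exact mul_le_one₀ (pow_le_one₀ (abs_nonneg _) (abs_coord_le i ω)) (abs_nonneg _) (Real.abs_cos_le_one _)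

lemma kk_slice (n : ℕ) : ∃ A, 0 < A ∧ ∀ (i : Fin (n+1)) (τ : ℝ) (z : E n), τ ≠ 0 →
    |kk (EuclideanSpace.single i 1) ((sl i).symm (τ, z))| ≤ A * |τ| ^ (-(n/2:ℝ)) := by
  obtain ⟨C, hC, h⟩ := kk_decay n
  refine ⟨max C ((sg (n+1)).real Set.univ), lt_max_of_lt_left hC, fun i τ z hτ => ?_⟩
  set x := (sl i).symm (τ, z) with hx
  have hτ0 : 0 < |τ| := abs_pos.2 hτ
  have h1 : |τ| ≤ ‖x‖ := by
    have := PiLp.norm_apply_le x i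
    rwa [hx, sl_symm_i, Real.norm_eq_abs] at this
  by_cases hx1 : 1 ≤ ‖x‖
  · refine (h _ _ (by simp) hx1).trans ?_
    gcongr ?_ * ?_
    · exact le_max_left _ _
    · exact Real.rpow_le_rpow_of_nonpos hτ0 h1 (by have := Nat.cast_nonneg (α := ℝ) n; linarith)
  · refine (kk_bound i x).trans ?_
    have h2 : 1 ≤ |τ| ^ (-(n/2:ℝ)) :=
      Real.one_le_rpow_of_pos_of_le_one_of_nonpos hτ0 (by linarith) (by have := Nat.cast_nonneg (α := ℝ) n; linarith)
    calc (sg (n+1)).real Set.univ ≤ max C ((sg (n+1)).real Set.univ) * 1 := by simp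
      _ ≤ _ := by gcongr

lemma TT_inf (n : ℕ) : ∃ A, 0 < A ∧ ∀ (i : Fin (n+1)) (τ : ℝ) (u : E n → ℂ), τ ≠ 0 → Integrable u →
    ∀ y, ‖TT i τ u y‖ ≤ A * |τ| ^ (-(n/2:ℝ)) * ∫ x, ‖u x‖ := by
  obtain ⟨A, hA, h⟩ := kk_slice n
  refine ⟨A, hA, fun i τ u hτ hu y => ?_⟩
  rw [TT_fub i τ hu, ← integral_const_mul]
  refine norm_integral_le_of_norm_le (hu.norm.const_mul _) (Filter.Eventually.of_forall fun x => ?_)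
  rw [norm_mul, Complex.norm_real, Real.norm_eq_abs]
  gcongr
  exact h i τ _ hτ

lemma TT_meas {n : ℕ} (i : Fin (n+1)) (τ : ℝ) {u : E n → ℂ} (hu : Integrable u) :
    StronglyMeasurable (TT i τ u) := by
  have h1 := fourierTf_cont hu
  have h2 := pr_cont (n := n) i
  have : Continuous (fun p : E n × Sp (n+1) =>
    ((((p.2 : E (n+1)) i ^ 2 : ℝ) : ℂ) * Complex.exp ((τ * (p.2 : E (n+1)) i + ⟪p.1, pr i p.2⟫ : ℝ) * I))
    * fourierTf u (pr i p.2)) := by fun_prop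
  exact this.stronglyMeasurable.integral_prod_right'

lemma TT_bdd {n : ℕ} (i : Fin (n+1)) (τ : ℝ) {u : E n → ℂ} (hu : Integrable u) (y : E n) :
    ‖TT i τ u y‖ ≤ (∫ x, ‖u x‖) * (sg (n+1)).real Set.univ := by
  refine norm_integral_le_of_norm_le_const (Filter.Eventually.of_forall fun ω => ?_)
  rw [norm_mul]
  calc _ ≤ 1 * ∫ x, ‖u x‖ := by
        gcongr
        · exact norm_wt i ω _
        · exact fourierTf_bound _ _
    _ = _ := one_mul _

lemma TT_add {n : ℕ} (i : Fin (n+1)) (τ : ℝ) {u v : E n → ℂ} (hu : Integrable u) (hv : Integrable v) (y : E n) :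
    TT i τ (fun x => u x + v x) y = TT i τ u y + TT i τ v y := by
  have h : ∀ ξ, fourierTf (fun x => u x + v x) ξ = fourierTf u ξ + fourierTf v ξ := by
    intro ξ
    simp only [fourierTf, mul_add]
    have hb : ∀ {w : E n → ℂ}, Integrable w →
        Integrable (fun x => cexp (-I * (⟪x, ξ⟫ : ℝ)) * w x) := by
      intro w hw
      refine hw.bdd_mul (c := 1) (by fun_prop) (Filter.Eventually.of_forall fun x => ?_)
      rw [Complex.norm_exp]; simp
    exact integral_add (hb hu) (hb hv)
  have h2 := pr_cont (n := n) i
  have hi : ∀ {w : E n → ℂ}, Integrable w → Integrable (fun ω : Sp (n+1) => 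
    ((((ω : E (n+1)) i ^ 2 : ℝ) : ℂ) * Complex.exp ((τ * (ω : E (n+1)) i + ⟪y, pr i ω⟫ : ℝ) * I))
    * fourierTf w (pr i ω)) (sg (n+1)) := by
    intro w hw
    have h1 := fourierTf_cont hw
    exact integrable_sphere _ (by fun_prop)
  simp only [TT, h, mul_add]
  exact integral_add (hi hu) (hi hv)

/-- the bilinear form -/
def BB {n : ℕ} (i : Fin (n+1)) (τ : ℝ) (u v : E n → ℂ) : ℂ :=
  ∫ ω : Sp (n+1), ((((ω : E (n+1)) i ^ 2 : ℝ) : ℂ) * Complex.exp ((τ * (ω : E (n+1)) i : ℝ) * I))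
    * (fourierTf u (pr i ω) * (starRingEnd ℂ) (fourierTf v (pr i ω))) ∂sg (n+1)

lemma TT_pair {n : ℕ} (i : Fin (n+1)) (τ : ℝ) {u v : E n → ℂ} (hu : Integrable u) (hv : Integrable v) :
    ∫ y, TT i τ u y * (starRingEnd ℂ) (v y) = BB i τ u v := by
  have h1 := fourierTf_cont hu
  have h2 := pr_cont (n := n) i
  have hv' : Integrable (fun y => (starRingEnd ℂ) (v y)) := 
    (Complex.conjLIE.toContinuousLinearEquiv.toContinuousLinearMap.integrable_comp hv)
  have hc := fub (n := n) (m := n+1)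
    (fun p => ((((p.1 : E (n+1)) i ^ 2 : ℝ) : ℂ) *
      Complex.exp ((τ * (p.1 : E (n+1)) i + ⟪p.2, pr i p.1⟫ : ℝ) * I)) * fourierTf u (pr i p.1)) (by
      fun_prop) (1 * ∫ x, ‖u x‖) (fun p => by
        rw [norm_mul]
        gcongr
        · exact norm_wt i p.1 _
        · exact fourierTf_bound _ _) hv'
  have hsw := integral_integral_swap (f := fun (ω : Sp (n+1)) (y : E n) =>
    (((((ω : E (n+1)) i ^ 2 : ℝ) : ℂ) *
      Complex.exp ((τ * (ω : E (n+1)) i + ⟪y, pr i ω⟫ : ℝ) * I)) * fourierTf u (pr i ω)) *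
        (starRingEnd ℂ) (v y)) hc
  calc _ = _ := by
        refine Eq.trans ?_ hsw.symm
        congr 1
        ext y
        rw [integral_mul_const, TT]
    _ = _ := by
        rw [BB]
        congr 1
        ext ω
        rw [fourierTf, fourierTf, ← integral_conj, ← fourierTf, ← integral_const_mul, ← integral_const_mul]
        congr 1
        ext y
        rw [map_mul, ← Complex.exp_conj]
        simp only [map_mul, map_neg, conj_I, conj_ofReal, neg_neg]
        have : cexp ((τ * (ω : E (n+1)) i + ⟪y, pr i ω⟫ : ℝ) * I) =
          cexp ((τ * (ω : E (n+1)) i : ℝ) * I) * cexp (I * (⟪y, pr i ω⟫ : ℝ)) := by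
          rw [← Complex.exp_add]; congr 1; push_cast; ring
        rw [this]
        ring

lemma BB_bound {n : ℕ} (i : Fin (n+1)) (τ : ℝ) {u v : E n → ℂ} (hu : Integrable u) (hv : Integrable v)
    (hu2 : MemLp u 2) (hv2 : MemLp v 2) :
    ‖BB i τ u v‖ₑ ≤ (2 * (n+1)) * ENNReal.ofReal ((2 * Real.pi) ^ n) *
      ((∫⁻ x, ‖u x‖ₑ ^ 2) ^ (1/2:ℝ) * (∫⁻ x, ‖v x‖ₑ ^ 2) ^ (1/2:ℝ)) := by
  have hp := pr_cont (n := n) i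
  have key : ∀ {w : E n → ℂ}, Integrable w → MemLp w 2 →
      ∫⁻ ω : Sp (n+1), (‖(ω : E (n+1)) i‖ₑ * ‖fourierTf w (pr i ω)‖ₑ) ^ (2:ℝ) ∂sg (n+1) ≤
        (2 * (n+1)) * ENNReal.ofReal ((2 * Real.pi) ^ n) * (∫⁻ x, ‖w x‖ₑ ^ 2) := by
    intro w hw hw2
    have h1 := fourierTf_cont hw
    have h := push i (fun ξ => ‖fourierTf w ξ‖ₑ ^ 2) (by fun_prop)
    rw [planch hw hw2, ← mul_assoc] at h
    refine le_trans (le_of_eq ?_) h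
    congr 1
    ext ω
    rw [ENNReal.rpow_ofNat, mul_pow, ← enorm_pow, Real.enorm_of_nonneg (by positivity)]
  have h1 := fourierTf_cont hu
  have h2 := fourierTf_cont hv
  calc ‖BB i τ u v‖ₑ ≤ ∫⁻ ω : Sp (n+1), ((‖(ω : E (n+1)) i‖ₑ * ‖fourierTf u (pr i ω)‖ₑ) *
        (‖(ω : E (n+1)) i‖ₑ * ‖fourierTf v (pr i ω)‖ₑ)) ∂sg (n+1) := by
        refine (enorm_integral_le_lintegral_enorm _).trans (le_of_eq ?_)
        congr 1
        ext ω
        rw [enorm_mul, enorm_mul, enorm_mul]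
        have e1 : ‖cexp ((τ * (ω : E (n+1)) i : ℝ) * I)‖ₑ = 1 := by
          rw [← ofReal_norm, Complex.norm_exp_ofReal_mul_I]; simp
        have e2 : ‖(((ω : E (n+1)) i ^ 2 : ℝ) : ℂ)‖ₑ = ‖(ω : E (n+1)) i‖ₑ ^ 2 := by
          rw [← enorm_pow, ← ofReal_norm, ← ofReal_norm, Complex.norm_real]
        have e3 : ‖(starRingEnd ℂ) (fourierTf v (pr i ω))‖ₑ = ‖fourierTf v (pr i ω)‖ₑ := by
          rw [← ofReal_norm, ← ofReal_norm, RCLike.norm_conj]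
        rw [e1, e2, e3]
        ring
    _ ≤ _ := ENNReal.lintegral_mul_le_Lp_mul_Lq _ Real.HolderConjugate.two_two
        (by fun_prop) (by fun_prop)
    _ ≤ ((2 * (n+1)) * ENNReal.ofReal ((2 * Real.pi) ^ n) * (∫⁻ x, ‖u x‖ₑ ^ 2)) ^ (1/2:ℝ) *
        ((2 * (n+1)) * ENNReal.ofReal ((2 * Real.pi) ^ n) * (∫⁻ x, ‖v x‖ₑ ^ 2)) ^ (1/2:ℝ) := by
        gcongr
        · exact key hu hu2
        · exact key hv hv2
    _ = _ := by
        set c : ℝ≥0∞ := (2 * (n+1)) * ENNReal.ofReal ((2 * Real.pi) ^ n)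
        rw [ENNReal.mul_rpow_of_nonneg c _ (by norm_num), ENNReal.mul_rpow_of_nonneg c _ (by norm_num)]
        have : c = c ^ (1/2:ℝ) * c ^ (1/2:ℝ) := by
          rw [← ENNReal.rpow_add_of_nonneg _ _ (by norm_num) (by norm_num)]; norm_num
        conv_rhs => rw [this]
        ring

/-- the L2 constant -/
def MM (n : ℕ) : ℝ≥0∞ := ((2 * (n+1)) * ENNReal.ofReal ((2 * Real.pi) ^ n)) ^ 2

lemma TT_two {n : ℕ} (i : Fin (n+1)) (τ : ℝ) {u : E n → ℂ} (hu : Integrable u) (hu2 : MemLp u 2) :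
    ∫⁻ y, ‖TT i τ u y‖ₑ ^ 2 ≤ MM n * ∫⁻ x, ‖u x‖ₑ ^ 2 := by
  have hm := TT_meas i τ hu
  have hloc : ∀ k : ℕ, ∫⁻ y in closedBall (0 : E n) k, ‖TT i τ u y‖ₑ ^ 2 ≤ MM n * ∫⁻ x, ‖u x‖ₑ ^ 2 := by
    intro k
    set v : E n → ℂ := (closedBall (0 : E n) k).indicator (TT i τ u) with hv
    have hmv : StronglyMeasurable v := hm.indicator isClosed_closedBall.measurableSet
    set K := (∫ x, ‖u x‖) * (sg (n+1)).real Set.univ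
    have hvLp : ∀ p : ℝ≥0∞, MemLp v p := by
      intro p
      rw [hv, memLp_indicator_iff_restrict isClosed_closedBall.measurableSet]
      have : IsFiniteMeasure ((volume : Measure (E n)).restrict (closedBall 0 k)) :=
        ⟨by simpa using! measure_closedBall_lt_top⟩
      exact MemLp.of_bound hm.aestronglyMeasurable K (Filter.Eventually.of_forall (TT_bdd i τ hu))
    have hv1 : Integrable v := memLp_one_iff_integrable.1 (hvLp 1)
    set X := ∫⁻ y, ‖v y‖ₑ ^ 2 with hX
    have hXtop : X ≠ ∞ := by
      have := (hvLp 2).eLpNorm_ne_top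
      rw [eLpNorm_eq_lintegral_rpow_enorm_toReal (by norm_num) (by norm_num)] at this
      intro hcon
      apply this
      simp only [ENNReal.toReal_ofNat, ENNReal.rpow_ofNat]
      rw [← hX, hcon]
      simp
    have hXe : ∫⁻ y in closedBall (0 : E n) k, ‖TT i τ u y‖ₑ ^ 2 = X := by
      rw [hX, ← lintegral_indicator isClosed_closedBall.measurableSet]
      congr 1
      ext y
      by_cases hy : y ∈ closedBall (0 : E n) k
      · simp [hv, Set.indicator_of_mem hy]
      · simp [hv, Set.indicator_of_notMem hy]
    have hB : ‖BB i τ u v‖ₑ = X := by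
      rw [← TT_pair i τ hu hv1]
      have : ∀ y, TT i τ u y * (starRingEnd ℂ) (v y) = ((‖v y‖ ^ 2 : ℝ) : ℂ) := by
        intro y
        by_cases hy : y ∈ closedBall (0 : E n) k
        · rw [hv, Set.indicator_of_mem hy, Complex.mul_conj, Complex.normSq_eq_norm_sq]
        · simp [hv, Set.indicator_of_notMem hy]
      simp_rw [this]
      rw [integral_complex_ofReal, ← ofReal_norm, Complex.norm_real,
        Real.norm_of_nonneg (by positivity), ofReal_integral_eq_lintegral_ofReal]
      · rw [hX]
        congr 1
        ext y
        rw [ENNReal.ofReal_pow (norm_nonneg _), ofReal_norm]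
      · exact (memLp_two_iff_integrable_sq_norm hmv.aestronglyMeasurable).1 (hvLp 2)
      · exact Filter.Eventually.of_forall fun y => by positivity
    have hb := BB_bound i τ hu hv1 hu2 (hvLp 2)
    rw [hB] at hb
    rw [hXe]
    set U := ∫⁻ x, ‖u x‖ₑ ^ 2 with hU
    rw [MM]
    set c : ℝ≥0∞ := (2 * (n+1)) * ENNReal.ofReal ((2 * Real.pi) ^ n)
    by_cases hX0 : X = 0
    · rw [hX0]; exact zero_le
    have hs : X ^ (1/2:ℝ) ≤ c * U ^ (1/2:ℝ) := by
      have e : X = X ^ (1/2:ℝ) * X ^ (1/2:ℝ) := by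
        rw [← ENNReal.rpow_add_of_nonneg _ _ (by norm_num) (by norm_num)]; norm_num
      rw [← mul_assoc] at hb
      conv_lhs at hb => rw [e]
      refine (ENNReal.mul_le_mul_iff_left ?_ ?_).1 hb
      · simp [hX0]
      · simp [hXtop]
    calc X = (X ^ (1/2:ℝ)) ^ 2 := by rw [← ENNReal.rpow_ofNat, ← ENNReal.rpow_mul]; norm_num
      _ ≤ (c * U ^ (1/2:ℝ)) ^ 2 := by gcongr
      _ = c ^ 2 * U := by
          rw [mul_pow]; congr 1; rw [← ENNReal.rpow_ofNat, ← ENNReal.rpow_mul]; norm_num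
  have hcov := aecover_closedBall (μ := (volume : Measure (E n))) (x := 0) (tendsto_natCast_atTop_atTop (R := ℝ))
  have ht := hcov.lintegral_tendsto_of_countably_generated (f := fun y => ‖TT i τ u y‖ₑ ^ 2)
    (by have := hm.measurable; fun_prop)
  exact le_of_tendsto' ht hloc

end ST

namespace ST

lemma lint_rpow (a b : ℝ) (ha : -1 < a) (hb : 0 ≤ b) :
    ∫⁻ t in Set.Ioc 0 b, ENNReal.ofReal (t ^ a) = ENNReal.ofReal (b ^ (a+1) / (a+1)) := by
  have h := intervalIntegral.intervalIntegrable_rpow' (a := 0) (b := b) ha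
  rw [intervalIntegrable_iff_integrableOn_Ioc_of_le hb] at h
  rw [← ofReal_integral_eq_lintegral_ofReal h]
  · rw [← intervalIntegral.integral_of_le hb, integral_rpow (Or.inl ha), Real.zero_rpow (by linarith), sub_zero]
  · refine (ae_restrict_iff' measurableSet_Ioc).2 (Filter.Eventually.of_forall fun t ht => ?_)
    exact Real.rpow_nonneg ht.1.le _

lemma marc {n : ℕ} (p q A N : ℝ) (M : ℝ≥0∞) (hp1 : 1 < p) (hp2 : p < 2) (hq : q = p / (p-1)) (hA : 0 < A)
    (T : (E n → ℂ) → E n → ℂ)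
    (hmeas : ∀ v, Integrable v → StronglyMeasurable (T v))
    (hadd : ∀ v w, Integrable v → Integrable w → ∀ y, T (fun x => v x + w x) y = T v y + T w y)
    (hinf : ∀ v, Integrable v → ∀ y, ‖T v y‖ ≤ A * ∫ x, ‖v x‖)
    (htwo : ∀ v, Integrable v → ∫⁻ y, ‖T v y‖ₑ ^ 2 ≤ M * ∫⁻ x, ‖v x‖ₑ ^ 2)
    (u : E n → ℂ) (hum : Measurable u) (hu : Integrable u) (hN : 0 < N)
    (huN : ∫⁻ x, ‖u x‖ₑ ^ p = ENNReal.ofReal N) :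
    ∫⁻ y, ‖T u y‖ₑ ^ q ≤ ENNReal.ofReal (4 * q / (q-2) * (2*A) ^ (q-2) * N ^ (q-1)) * M := by
  have hp0 : 0 < p - 1 := by linarith
  have hq2 : 2 < q := by rw [hq, lt_div_iff₀ hp0]; linarith
  have hpq : (p-1) * q = p := by rw [hq]; field_simp
  set B := 2 * A * N with hB
  have hBpos : 0 < B := by positivity
  have hmT := hmeas u hu
  have hnm : Measurable fun x => ‖u x‖ := hum.norm
  -- truncation
  set S : ℝ → Set (E n) := fun t => {x | t * ‖u x‖ ^ (p-1) ≤ B} with hS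
  have hSm : ∀ t, MeasurableSet (S t) := fun t =>
    measurableSet_le (by fun_prop) measurable_const
  have step : ∀ t : ℝ, 0 < t → volume {y | t < ‖T u y‖} * ENNReal.ofReal (t ^ (q-1)) ≤
      M * ∫⁻ x, ENNReal.ofReal (4 * t ^ (q-3)) * (S t).indicator (fun x => ‖u x‖ₑ ^ 2) x := by
    intro t ht
    set u2 := (S t).indicator u
    set u1 := (S t)ᶜ.indicator u
    have hu2 : Integrable u2 := hu.indicator (hSm t)
    have hu1 : Integrable u1 := hu.indicator (hSm t).compl
    have hsum : u = fun x => u1 x + u2 x := by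
      ext x
      by_cases hx : x ∈ S t
      · simp [u1, u2, hx]
      · simp [u1, u2, hx]
    have hb1 : A * ∫ x, ‖u1 x‖ ≤ t / 2 := by
      have hI : ∫ x, ‖u1 x‖ ≤ t / B * N := by
        have e1 : ENNReal.ofReal (∫ x, ‖u1 x‖) ≤ ENNReal.ofReal (t / B * N) := by
          rw [ofReal_integral_eq_lintegral_ofReal hu1.norm (Filter.Eventually.of_forall fun _ => norm_nonneg _),
            ENNReal.ofReal_mul (by positivity), ← huN, ← lintegral_const_mul _ (by fun_prop)]
          refine lintegral_mono fun x => ?_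
          by_cases hx : x ∈ S t
          · simp [u1, hx]
          · have hx' : B < t * ‖u x‖ ^ (p-1) := not_le.1 hx
            have e2 : u1 x = u x := Set.indicator_of_mem (by simpa using hx) u
            simp only [e2]
            rw [← ofReal_norm, ENNReal.ofReal_rpow_of_nonneg (norm_nonneg _) (by linarith),
              ← ENNReal.ofReal_mul (by positivity)]
            apply ENNReal.ofReal_le_ofReal
            have hu0 : 0 < ‖u x‖ := by
              rcases (norm_nonneg (u x)).eq_or_lt with h0 | h0
              · rw [← h0, Real.zero_rpow hp0.ne'] at hx'; linarith
              · exact h0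
            have e3 : ‖u x‖ ^ p = ‖u x‖ ^ (p-1) * ‖u x‖ := by
              rw [← Real.rpow_add_one hu0.ne']; congr 1; ring
            rw [e3, div_mul_eq_mul_div, le_div_iff₀ hBpos]
            nlinarith
        exact (ENNReal.ofReal_le_ofReal_iff (by positivity)).1 e1
      calc A * ∫ x, ‖u1 x‖ ≤ A * (t / B * N) := by gcongr
        _ = t / 2 := by rw [hB]; field_simp
    have hsub : {y | t < ‖T u y‖} ⊆ {y | ENNReal.ofReal ((t/2)^2) ≤ ‖T u2 y‖ₑ ^ 2} := by
      intro y hy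
      have hy' : t < ‖T u y‖ := hy
      rw [hsum, hadd _ _ hu1 hu2] at hy'
      have h1 := (hinf u1 hu1 y).trans hb1
      have h2 := norm_add_le (T u1 y) (T u2 y)
      have h3 : t / 2 ≤ ‖T u2 y‖ := by linarith
      show ENNReal.ofReal ((t/2)^2) ≤ ‖T u2 y‖ₑ ^ 2
      rw [← ofReal_norm, ← ENNReal.ofReal_pow (norm_nonneg _)]
      apply ENNReal.ofReal_le_ofReal
      gcongr
    have hch := mul_meas_ge_le_lintegral (μ := volume) (f := fun y => ‖T u2 y‖ₑ ^ 2)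
      (by have := (hmeas u2 hu2).measurable; fun_prop) (ENNReal.ofReal ((t/2)^2))
    have e4 : ENNReal.ofReal (t ^ (q-1)) = ENNReal.ofReal (4 * t ^ (q-3)) * ENNReal.ofReal ((t/2)^2) := by
      rw [← ENNReal.ofReal_mul (by positivity)]
      congr 1
      have : t ^ (q-1) = t ^ (q-3) * t ^ 2 := by
        rw [← Real.rpow_natCast, ← Real.rpow_add ht]; congr 1; norm_num; ring
      rw [this]; ring
    calc _ ≤ volume {y | ENNReal.ofReal ((t/2)^2) ≤ ‖T u2 y‖ₑ ^ 2} * ENNReal.ofReal (t ^ (q-1)) := by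
          gcongr
      _ = ENNReal.ofReal (4 * t ^ (q-3)) * (ENNReal.ofReal ((t/2)^2) *
          volume {y | ENNReal.ofReal ((t/2)^2) ≤ ‖T u2 y‖ₑ ^ 2}) := by rw [e4]; ring
      _ ≤ ENNReal.ofReal (4 * t ^ (q-3)) * (M * ∫⁻ x, ‖u2 x‖ₑ ^ 2) := by
          gcongr _ * ?_
          exact hch.trans (htwo u2 hu2)
      _ = M * (ENNReal.ofReal (4 * t ^ (q-3)) * ∫⁻ x, ‖u2 x‖ₑ ^ 2) := by ring
      _ = _ := by
          rw [← lintegral_const_mul _ (by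
            have : Measurable u2 := hum.indicator (hSm t)
            fun_prop)]
          congr 2
          ext x
          by_cases hx : x ∈ S t
          · simp [u2, hx]
          · simp [u2, hx]
  have hl := lintegral_rpow_eq_lintegral_meas_lt_mul (volume : Measure (E n)) (f := fun y => ‖T u y‖)
    (Filter.Eventually.of_forall fun _ => norm_nonneg _) hmT.measurable.norm.aemeasurable (p := q) (by linarith)
  have hl' : ∫⁻ y, ‖T u y‖ₑ ^ q = ENNReal.ofReal q * ∫⁻ t in Set.Ioi 0, volume {y | t < ‖T u y‖} * ENNReal.ofReal (t ^ (q-1)) := by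
    rw [← hl]
    congr 1
    ext y
    rw [← ofReal_norm, ENNReal.ofReal_rpow_of_nonneg (norm_nonneg _) (by linarith)]
  have hjm : Measurable (fun z : ℝ × E n => ENNReal.ofReal (4 * z.1 ^ (q-3)) * (S z.1).indicator (fun x => ‖u x‖ₑ ^ 2) z.2) := by
    have e : (fun z : ℝ × E n => (S z.1).indicator (fun x => ‖u x‖ₑ ^ 2) z.2) =
      {z : ℝ × E n | z.1 * ‖u z.2‖ ^ (p-1) ≤ B}.indicator (fun z => ‖u z.2‖ₑ ^ 2) := by
      ext z
      by_cases hz : z.2 ∈ S z.1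
      · rw [Set.indicator_of_mem hz, Set.indicator_of_mem (by exact hz)]
      · rw [Set.indicator_of_notMem hz, Set.indicator_of_notMem (by exact hz)]
    refine Measurable.mul (by fun_prop) ?_
    rw [e]
    exact Measurable.indicator (by fun_prop) (measurableSet_le (by fun_prop) measurable_const)
  have inner : ∀ x, ∫⁻ t in Set.Ioi (0:ℝ), ENNReal.ofReal (4 * t ^ (q-3)) * (S t).indicator (fun x => ‖u x‖ₑ ^ 2) x
      ≤ ENNReal.ofReal (4 / (q-2) * B ^ (q-2)) * ‖u x‖ₑ ^ p := by
    intro x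
    by_cases hx0 : u x = 0
    · have : ∀ t, (S t).indicator (fun x => ‖u x‖ₑ ^ 2) x = 0 := by
        intro t
        by_cases hx : x ∈ S t
        · rw [Set.indicator_of_mem hx, hx0]; simp
        · rw [Set.indicator_of_notMem hx]
      simp [this]
    have hu0 : 0 < ‖u x‖ := norm_pos_iff.2 hx0
    set b := B / ‖u x‖ ^ (p-1) with hb
    have hb0 : 0 < b := by positivity
    have e1 : ∫⁻ t in Set.Ioi (0:ℝ), ENNReal.ofReal (4 * t ^ (q-3)) * (S t).indicator (fun x => ‖u x‖ₑ ^ 2) x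
        = ∫⁻ t in Set.Ioc 0 b, ENNReal.ofReal (4 * t ^ (q-3)) * ‖u x‖ₑ ^ 2 := by
      rw [← lintegral_indicator measurableSet_Ioi, ← lintegral_indicator measurableSet_Ioc]
      congr 1
      ext t
      by_cases ht : 0 < t
      · by_cases hx : x ∈ S t
        · have : t ∈ Set.Ioc 0 b := ⟨ht, by rw [hb, le_div_iff₀ (by positivity)]; exact hx⟩
          rw [Set.indicator_of_mem (by exact ht), Set.indicator_of_mem hx, Set.indicator_of_mem this]
        · have : t ∉ Set.Ioc 0 b := fun h => hx (by
            have := h.2; rw [hb, le_div_iff₀ (by positivity)] at this; exact this)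
          rw [Set.indicator_of_mem (by exact ht), Set.indicator_of_notMem hx, Set.indicator_of_notMem this, mul_zero]
      · rw [Set.indicator_of_notMem (by exact ht), Set.indicator_of_notMem (fun h => ht h.1)]
    rw [e1, lintegral_mul_const _ (by fun_prop)]
    simp_rw [ENNReal.ofReal_mul (show (0:ℝ) ≤ 4 by norm_num)]
    rw [lintegral_const_mul _ (by fun_prop), lint_rpow _ _ (by linarith) hb0.le,
      ← ENNReal.ofReal_mul (by norm_num), ← ofReal_norm, ← ENNReal.ofReal_pow (norm_nonneg _),
      ENNReal.ofReal_rpow_of_nonneg (norm_nonneg _) (by linarith), ← ENNReal.ofReal_mul (by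
        have : 0 < q - 3 + 1 := by linarith
        positivity),
      ← ENNReal.ofReal_mul (by have : 0 < q - 2 := by linarith
                               positivity)]
    apply ENNReal.ofReal_le_ofReal
    apply le_of_eq
    have e2 : q - 3 + 1 = q - 2 := by ring
    rw [e2, hb, Real.div_rpow hBpos.le (by positivity), ← Real.rpow_mul hu0.le]
    have e3 : ‖u x‖ ^ 2 = ‖u x‖ ^ p * ‖u x‖ ^ ((p-1)*(q-2)) := by
      rw [← Real.rpow_natCast, ← Real.rpow_add hu0]; congr 1; push_cast; linarith
    rw [e3]
    have : 0 < q - 2 := by linarith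
    field_simp
  calc ∫⁻ y, ‖T u y‖ₑ ^ q = _ := hl'
    _ ≤ ENNReal.ofReal q * ∫⁻ t in Set.Ioi (0:ℝ), M * ∫⁻ x, ENNReal.ofReal (4 * t ^ (q-3)) * (S t).indicator (fun x => ‖u x‖ₑ ^ 2) x := by
        gcongr 1
        exact setLIntegral_mono' measurableSet_Ioi fun t ht => step t ht
    _ = ENNReal.ofReal q * (M * ∫⁻ x, ∫⁻ t in Set.Ioi (0:ℝ), ENNReal.ofReal (4 * t ^ (q-3)) * (S t).indicator (fun x => ‖u x‖ₑ ^ 2) x) := by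
        rw [lintegral_const_mul _ hjm.lintegral_prod_right', lintegral_lintegral_swap hjm.aemeasurable]
    _ ≤ ENNReal.ofReal q * (M * ∫⁻ x, ENNReal.ofReal (4 / (q-2) * B ^ (q-2)) * ‖u x‖ₑ ^ p) := by
        gcongr 2
        exact lintegral_mono inner
    _ = _ := by
        have : 0 < q - 2 := by linarith
        rw [lintegral_const_mul _ (by fun_prop), huN, mul_comm M, ← mul_assoc, ← mul_assoc,
          ← ENNReal.ofReal_mul (by linarith), ← ENNReal.ofReal_mul (by positivity)]
        congr 2
        rw [hB, Real.mul_rpow (by positivity) hN.le]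
        have e5 : N ^ (q-1) = N ^ (q-2) * N := by rw [← Real.rpow_add_one hN.ne']; congr 1; ring
        rw [e5]
        ring

/-- Holder duality: the slice bilinear estimate. -/
lemma BB_est (n : ℕ) (hn : 1 ≤ n) (p γ : ℝ) (hp : p = 2 * (n+2) / (n+4)) (hγ : γ = n / (n+2)) :
    ∃ C, 0 < C ∧ ∀ (i : Fin (n+1)) (τ : ℝ) (u v : E n → ℂ), τ ≠ 0 → Measurable u → Measurable v →
      Integrable u → Integrable v →
      ‖BB i τ u v‖ₑ ≤ ENNReal.ofReal (C * |τ| ^ (-γ)) * ((∫⁻ x, ‖u x‖ₑ ^ p) ^ (1/p) * (∫⁻ x, ‖v x‖ₑ ^ p) ^ (1/p)) := by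
  obtain ⟨A, hA, hinf⟩ := TT_inf n
  have hn' : (1:ℝ) ≤ n := by exact_mod_cast hn
  have hp1 : 1 < p := by rw [hp, lt_div_iff₀ (by positivity)]; linarith
  have hp2 : p < 2 := by rw [hp, div_lt_iff₀ (by positivity)]; linarith
  set q := p / (p-1) with hq
  have hp0 : 0 < p - 1 := by linarith
  have hq2 : 2 < q := by rw [hq, lt_div_iff₀ hp0]; linarith
  have hpq : (p-1) * q = p := by rw [hq]; field_simp
  have hq' : q = 2 * (n+2) / n := by
    have : p - 1 = n / (n+4) := by rw [hp]; field_simp; ring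
    rw [hq, this, hp]; field_simp
  have hconj : q.HolderConjugate p := by
    have := Real.HolderConjugate.conjExponent hp1
    exact this.symm
  set M := MM n with hM
  have hMtop : M ≠ ∞ := by rw [hM, MM]; finiteness
  have hM0 : M ≠ 0 := by
    rw [hM, MM]
    refine pow_ne_zero _ (mul_ne_zero (mul_ne_zero (by norm_num) (by positivity)) ?_)
    rw [Ne, ENNReal.ofReal_eq_zero, not_le]; positivity
  set Mr := M.toReal with hMr
  have hMr0 : 0 < Mr := ENNReal.toReal_pos hM0 hMtop
  set C := (4 * q / (q-2) * (2*A) ^ (q-2) * Mr) ^ (1/q) with hC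
  have hq20 : 0 < q - 2 := by linarith
  refine ⟨C, by positivity, fun i τ u v hτ hum hvm hu hv => ?_⟩
  have hτ0 : 0 < |τ| := abs_pos.2 hτ
  set P := ∫⁻ x, ‖u x‖ₑ ^ p with hP
  set Q := ∫⁻ x, ‖v x‖ₑ ^ p with hQ
  have hzero : ∀ {w : E n → ℂ}, Measurable w → ∫⁻ x, ‖w x‖ₑ ^ p = 0 → ∀ᵐ x, w x = 0 := by
    intro w hw h
    rw [lintegral_eq_zero_iff (by fun_prop)] at h
    filter_upwards [h] with x hx
    have := (ENNReal.rpow_eq_zero_iff_of_pos (by linarith : 0 < p)).1 hx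
    simpa using this
  have hF0 : ∀ {w : E n → ℂ}, (∀ᵐ x, w x = 0) → ∀ ξ, fourierTf w ξ = 0 := by
    intro w h ξ
    rw [fourierTf]
    refine integral_eq_zero_of_ae ?_
    filter_upwards [h] with x hx
    simp [hx]
  by_cases hP0 : P = 0
  · have : BB i τ u v = 0 := by simp [BB, hF0 (hzero hum hP0)]
    rw [this]; simp
  by_cases hQ0 : Q = 0
  · have : BB i τ u v = 0 := by simp [BB, hF0 (hzero hvm hQ0)]
    rw [this]; simp
  have hcpos : 0 < C * |τ| ^ (-γ) := by positivity
  have hc0 : ENNReal.ofReal (C * |τ| ^ (-γ)) ≠ 0 := by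
    rw [Ne, ENNReal.ofReal_eq_zero, not_le]; exact hcpos
  have hip : 0 < 1 / p := by positivity
  by_cases hPt : P = ∞
  · rw [hPt, ENNReal.top_rpow_of_pos hip, ENNReal.top_mul (by simp only [Ne, ENNReal.rpow_eq_zero_iff_of_pos hip]; exact hQ0), ENNReal.mul_top hc0]
    exact le_top
  set A' := A * |τ| ^ (-(n/2:ℝ)) with hA'
  have hA'0 : 0 < A' := by positivity
  set N := P.toReal with hN
  have hN0 : 0 < N := ENNReal.toReal_pos hP0 hPt
  have hPN : P = ENNReal.ofReal N := (ENNReal.ofReal_toReal hPt).symm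
  have hm := marc p q A' N M hp1 hp2 hq hA'0 (TT i τ) (fun w hw => TT_meas i τ hw)
    (fun v w hv hw y => TT_add i τ hv hw y) (fun w hw y => hinf i τ w hτ hw y)
    (fun w hw => by
      by_cases hw2 : MemLp w 2
      · exact TT_two i τ hw hw2
      · have : ∫⁻ x, ‖w x‖ₑ ^ 2 = ∞ := by
          by_contra hcon
          apply hw2
          refine ⟨hw.1, ?_⟩
          rw [eLpNorm_eq_lintegral_rpow_enorm_toReal (by norm_num) (by norm_num)]
          simp only [ENNReal.toReal_ofNat, ENNReal.rpow_ofNat]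
          exact ENNReal.rpow_lt_top_of_nonneg (by norm_num) hcon
        rw [this, ENNReal.mul_top hM0]
        exact le_top)
    u hum hu hN0 hPN
  have hTm := (TT_meas i τ hu).measurable
  calc ‖BB i τ u v‖ₑ = ‖∫ y, TT i τ u y * (starRingEnd ℂ) (v y)‖ₑ := by rw [TT_pair i τ hu hv]
    _ ≤ ∫⁻ y, ‖TT i τ u y‖ₑ * ‖v y‖ₑ := by
        refine (enorm_integral_le_lintegral_enorm _).trans (le_of_eq ?_)
        congr 1
        ext y
        rw [enorm_mul]
        congr 1
        rw [← ofReal_norm, ← ofReal_norm, RCLike.norm_conj]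
    _ ≤ (∫⁻ y, ‖TT i τ u y‖ₑ ^ q) ^ (1/q) * Q ^ (1/p) :=
        ENNReal.lintegral_mul_le_Lp_mul_Lq _ hconj (by fun_prop) (by fun_prop)
    _ ≤ (ENNReal.ofReal (4 * q / (q-2) * (2*A') ^ (q-2) * N ^ (q-1)) * M) ^ (1/q) * Q ^ (1/p) := by
        gcongr
    _ = ENNReal.ofReal (C * |τ| ^ (-γ)) * P ^ (1/p) * Q ^ (1/p) := by
        congr 1
        have hMM : M = ENNReal.ofReal Mr := (ENNReal.ofReal_toReal hMtop).symm
        rw [hMM, hPN, ← ENNReal.ofReal_mul (by positivity), ENNReal.ofReal_rpow_of_nonneg (by positivity) (by positivity),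
          ENNReal.ofReal_rpow_of_nonneg (by positivity) (by positivity), ← ENNReal.ofReal_mul (by positivity)]
        congr 1
        have e1 : 4 * q / (q-2) * (2*A') ^ (q-2) * N ^ (q-1) * Mr =
          (4 * q / (q-2) * (2*A) ^ (q-2) * Mr) * ((|τ| ^ (-(n/2:ℝ))) ^ (q-2) * N ^ (q-1)) := by
          rw [hA', ← mul_assoc 2 A, Real.mul_rpow (by positivity) (by positivity)]
          ring
        rw [e1, Real.mul_rpow (by positivity) (by positivity), ← hC, Real.mul_rpow (by positivity) (by positivity),
          ← Real.rpow_mul hτ0.le, ← Real.rpow_mul hτ0.le, ← Real.rpow_mul hN0.le]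
        have hq0 : q ≠ 0 := by linarith
        have e2 : -(n/2:ℝ) * (q-2) * (1/q) = -γ := by
          rw [hγ, hq']; field_simp; ring
        have e3 : (q-1) * (1/q) = 1/p := by
          rw [hq]; field_simp; ring
        have e2' : -(n/2:ℝ) * ((q-2) * (1/q)) = -γ := by rw [← e2]; ring
        simp only [e2, e2', e3]
        ring
    _ = _ := by ring

end ST

namespace ST

lemma lint_abs (s : ℝ) (g : ℝ → ℝ≥0∞) :
    ∫⁻ t, g |s - t| = 2 * ∫⁻ t in Set.Ioi 0, g t := by
  rw [lintegral_sub_left_eq_self (fun t => g |t|) s,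
    ← lintegral_add_compl (fun t => g |t|) (measurableSet_Ioi (a := (0:ℝ)))]
  have e1 : ∫⁻ t in Set.Ioi (0:ℝ), g |t| = ∫⁻ t in Set.Ioi 0, g t :=
    setLIntegral_congr_fun measurableSet_Ioi fun t ht => by simp only [abs_of_pos (show 0 < t from ht)]
  have e2 : ∫⁻ t in (Set.Ioi (0:ℝ))ᶜ, g |t| = ∫⁻ t in Set.Ioi (0:ℝ), g |t| := by
    rw [← setLIntegral_congr (Ioi_ae_eq_Ici (a := (0:ℝ)) (μ := volume)).symm, 
      ← lintegral_indicator measurableSet_Ioi.compl, ← lintegral_indicator measurableSet_Ici,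
      ← lintegral_neg_eq_self]
    congr 1
    ext t
    by_cases ht : 0 ≤ t
    · rw [Set.indicator_of_mem (by simpa using ht), Set.indicator_of_mem (by simpa using ht), abs_neg]
    · rw [Set.indicator_of_notMem (by simpa using ht), Set.indicator_of_notMem (by simpa using ht)]
  rw [e2, e1, two_mul]

lemma near_int (s r γ : ℝ) (hr : 0 ≤ r) (hγ : γ < 1) :
    ∫⁻ t, {t : ℝ | |s - t| ≤ r}.indicator (fun t => ENNReal.ofReal (|s - t| ^ (-γ))) t
      = ENNReal.ofReal (2 * (r ^ (1-γ) / (1-γ))) := by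
  have h := lint_abs s ((Set.Iic r).indicator fun t => ENNReal.ofReal (t ^ (-γ)))
  refine Eq.trans (Eq.trans ?_ h) ?_
  · congr 1
  · rw [lintegral_indicator measurableSet_Iic, Measure.restrict_restrict measurableSet_Iic,
      Set.Iic_inter_Ioi, lint_rpow _ _ (by linarith) hr, ENNReal.ofReal_mul (by norm_num)]
    have : -γ + 1 = 1 - γ := by ring
    rw [this]
    simp

lemma far_int (s r : ℝ) (hr : 0 < r) :
    ∫⁻ t, {t : ℝ | r < |s - t|}.indicator (fun t => ENNReal.ofReal (|s - t| ^ (-2:ℝ))) t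
      = ENNReal.ofReal (2 / r) := by
  have h := lint_abs s ((Set.Ioi r).indicator fun t => ENNReal.ofReal (t ^ (-2:ℝ)))
  refine Eq.trans (Eq.trans ?_ h) ?_
  · congr 1
  · have e : Set.Ioi r ∩ Set.Ioi 0 = Set.Ioi r := by
      rw [Set.Ioi_inter_Ioi, max_eq_left hr.le]
    rw [lintegral_indicator measurableSet_Ioi, Measure.restrict_restrict measurableSet_Ioi, e,
      ← ofReal_integral_eq_lintegral_ofReal (integrableOn_Ioi_rpow_of_lt (by norm_num) hr),
      integral_Ioi_rpow_of_lt (by norm_num) hr]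
    · have e2 : -r ^ (-2 + 1 : ℝ) / (-2 + 1) = r⁻¹ := by
        norm_num
        rw [Real.rpow_neg_one]
      rw [e2, div_eq_mul_inv, ENNReal.ofReal_mul (by norm_num)]
      simp
    · refine (ae_restrict_iff' measurableSet_Ioi).2 (Filter.Eventually.of_forall fun t ht => ?_)
      exact Real.rpow_nonneg (hr.trans ht).le _

lemma hls (p γ : ℝ) (hp1 : 1 < p) (hp2 : p < 2) (hγ : γ = 2 - 2/p) : ∃ C, 0 < C ∧
    ∀ F : ℝ → ℝ≥0∞, Measurable F →
      ∫⁻ s, ∫⁻ t, F s * F t * ENNReal.ofReal (|s-t| ^ (-γ)) ≤ ENNReal.ofReal C * (∫⁻ s, F s ^ p) ^ (2/p) := by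
  set q := p / (p-1) with hq
  have hp0 : 0 < p - 1 := by linarith
  have hpp : 0 < p := by linarith
  have hq2 : 2 < q := by rw [hq, lt_div_iff₀ hp0]; linarith
  have hγq : γ * q = 2 := by rw [hγ, hq]; field_simp
  have hγ0 : 0 < γ := by
    have : 0 < γ * q := by rw [hγq]; norm_num
    exact pos_of_mul_pos_left this (by linarith)
  have hγ1 : γ < 1 := by
    have : 1 < 2/p := by rw [lt_div_iff₀ hpp]; linarith
    linarith
  have hγ1' : 0 < 1 - γ := by linarith
  have hconj : p.HolderConjugate q := Real.HolderConjugate.conjExponent hp1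
  set C0 := 2 / (1-γ) + 2 ^ (1/q) with hC0
  have hC0p : 0 < C0 := by positivity
  refine ⟨2 * C0, by positivity, fun F hF => ?_⟩
  set N := ∫⁻ s, F s ^ p with hN
  have hpi : 0 < 2/p := by positivity
  by_cases hNt : N = ∞
  · rw [hNt, ENNReal.top_rpow_of_pos hpi, ENNReal.mul_top]
    · exact le_top
    · rw [Ne, ENNReal.ofReal_eq_zero, not_le]; positivity
  by_cases hN0 : N = 0
  · have h := hN0
    rw [hN, lintegral_eq_zero_iff (by fun_prop)] at h
    have : ∫⁻ s, ∫⁻ t, F s * F t * ENNReal.ofReal (|s-t| ^ (-γ)) = 0 := by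
      refine lintegral_eq_zero_of_ae_eq_zero ?_
      filter_upwards [h] with s hs
      have hs' : F s = 0 := (ENNReal.rpow_eq_zero_iff_of_pos hpp).1 hs
      simp [hs']
    rw [this]; exact zero_le
  set m := N.toReal with hm
  have hm0 : 0 < m := ENNReal.toReal_pos hN0 hNt
  have hNm : N = ENNReal.ofReal m := (ENNReal.ofReal_toReal hNt).symm
  set kf : ℝ → ℝ → ℝ≥0∞ := fun s t => ENNReal.ofReal (|s-t| ^ (-γ)) with hkf
  set D : Set (ℝ × ℝ) := {z | F z.2 ≤ F z.1} with hD
  have hDm : MeasurableSet D := measurableSet_le (by fun_prop) (by fun_prop)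
  set G : ℝ × ℝ → ℝ≥0∞ := D.indicator (fun z => F z.1 * F z.2 * kf z.1 z.2) with hG
  have hG0m : Measurable (fun z : ℝ × ℝ => F z.1 * F z.2 * kf z.1 z.2) := by fun_prop
  have hGm : Measurable G := hG0m.indicator hDm
  have key : ∀ s, F s ≠ ∞ → ∫⁻ t, G (s, t) ≤ ENNReal.ofReal (C0 * m ^ (2/p-1)) * F s ^ p := by
    intro s hst
    by_cases hs0 : F s = 0
    · have : ∀ t, G (s,t) = 0 := by
        intro t
        simp [hG, Set.indicator_apply, hs0]
      simp [this]
    set a := (F s).toReal with ha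
    have ha0 : 0 < a := ENNReal.toReal_pos hs0 hst
    have hFa : F s = ENNReal.ofReal a := (ENNReal.ofReal_toReal hst).symm
    set r := m / a ^ p with hr
    have hr0 : 0 < r := by positivity
    have hpt : ∀ t, G (s,t) ≤ F s * (F s * {t : ℝ | |s - t| ≤ r}.indicator (fun t => kf s t) t +
        F t * {t : ℝ | r < |s - t|}.indicator (fun t => kf s t) t) := by
      intro t
      by_cases hd : (s,t) ∈ D
      · rw [hG, Set.indicator_of_mem hd]
        by_cases ht : |s - t| ≤ r
        · rw [Set.indicator_of_mem (by exact ht), Set.indicator_of_notMem (by simpa using ht), mul_zero, add_zero,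
            mul_assoc]
          gcongr
          exact hd
        · rw [Set.indicator_of_notMem (by exact ht), Set.indicator_of_mem (by simpa using ht), mul_zero, zero_add,
            mul_assoc]
      · rw [hG, Set.indicator_of_notMem hd]; exact zero_le
    have hkm : Measurable (kf s) := by fun_prop
    have hs1 : MeasurableSet {t : ℝ | |s - t| ≤ r} := measurableSet_le (by fun_prop) measurable_const
    have hs2 : MeasurableSet {t : ℝ | r < |s - t|} := measurableSet_lt measurable_const (by fun_prop)
    have hk1 : Measurable ({t : ℝ | |s - t| ≤ r}.indicator (fun t => kf s t)) := hkm.indicator hs1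
    have hk2 : Measurable ({t : ℝ | r < |s - t|}.indicator (fun t => kf s t)) := hkm.indicator hs2
    have hfar : ∫⁻ t, F t * {t : ℝ | r < |s - t|}.indicator (fun t => kf s t) t ≤
        N ^ (1/p) * ENNReal.ofReal (2/r) ^ (1/q) := by
      refine (ENNReal.lintegral_mul_le_Lp_mul_Lq _ hconj hF.aemeasurable hk2.aemeasurable).trans ?_
      gcongr
      rw [← far_int s r hr0]
      apply le_of_eq
      congr 1
      ext t
      by_cases ht : r < |s - t|
      · rw [Set.indicator_of_mem (by exact ht), Set.indicator_of_mem (by exact ht), hkf]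
        simp only
        rw [ENNReal.ofReal_rpow_of_nonneg (by positivity) (by linarith), ← Real.rpow_mul (by positivity)]
        congr 2
        linarith
      · rw [Set.indicator_of_notMem (by exact ht), Set.indicator_of_notMem (by exact ht),
          ENNReal.zero_rpow_of_pos (by linarith)]
    calc ∫⁻ t, G (s,t) ≤ ∫⁻ t, F s * (F s * {t : ℝ | |s - t| ≤ r}.indicator (fun t => kf s t) t +
        F t * {t : ℝ | r < |s - t|}.indicator (fun t => kf s t) t) := lintegral_mono hpt
      _ = F s * (F s * ENNReal.ofReal (2 * (r ^ (1-γ) / (1-γ))) +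
          ∫⁻ t, F t * {t : ℝ | r < |s - t|}.indicator (fun t => kf s t) t) := by
          rw [lintegral_const_mul _ (by fun_prop), lintegral_add_left (by fun_prop), lintegral_const_mul _ hk1,
            near_int s r γ hr0.le hγ1]
      _ ≤ F s * (F s * ENNReal.ofReal (2 * (r ^ (1-γ) / (1-γ))) + N ^ (1/p) * ENNReal.ofReal (2/r) ^ (1/q)) := by
          gcongr
      _ = _ := by
          rw [hFa, hNm, ENNReal.ofReal_rpow_of_nonneg (by positivity) (by positivity),
            ENNReal.ofReal_rpow_of_nonneg (by positivity) (by positivity),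
            ENNReal.ofReal_rpow_of_nonneg (by positivity) (by positivity),
            ← ENNReal.ofReal_mul (by positivity), ← ENNReal.ofReal_mul (by positivity),
            ← ENNReal.ofReal_add (by positivity) (by positivity), ← ENNReal.ofReal_mul (by positivity),
            ← ENNReal.ofReal_mul (by positivity)]
          congr 1
          have e1 : a * r ^ (1-γ) = m ^ (2/p-1) * a ^ (p-1) := by
            have h1 : 1 - γ = 2/p - 1 := by rw [hγ]; ring
            rw [hr, h1, Real.div_rpow hm0.le (by positivity), ← Real.rpow_mul ha0.le]
            have h2 : a = a ^ (p-1) * a ^ (p * (2/p-1)) := by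
              rw [← Real.rpow_add ha0]
              have : p - 1 + p * (2/p-1) = 1 := by field_simp; ring
              rw [this, Real.rpow_one]
            have h3 : 0 < a ^ (p * (2/p-1)) := by positivity
            conv_lhs => enter [1]; rw [h2]
            field_simp
          have e2 : m ^ (1/p) * (2/r) ^ (1/q) = 2 ^ (1/q) * (m ^ (2/p-1) * a ^ (p-1)) := by
            have h1 : 2 / r = 2 * (m⁻¹ * a ^ p) := by rw [hr]; field_simp
            have h2 : p * (1/q) = p - 1 := by rw [hq]; field_simp
            have h3 : m ^ (2/p-1) = m ^ (1/p) * m ^ (-(1/q)) := by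
              rw [← Real.rpow_add hm0]; congr 1; rw [hq]; field_simp; ring
            rw [h1, Real.mul_rpow (by norm_num) (by positivity), Real.mul_rpow (by positivity) (by positivity),
              ← Real.rpow_mul ha0.le, h2, h3, Real.inv_rpow hm0.le, Real.rpow_neg hm0.le]
            ring
          have e3 : a ^ p = a * a ^ (p-1) := by
            rw [mul_comm, ← Real.rpow_add_one ha0.ne']; congr 1; ring
          rw [e2, e3, hC0]
          calc _ = a * (2 / (1-γ) * (a * r ^ (1-γ)) + 2 ^ (1/q) * (m ^ (2/p-1) * a ^ (p-1))) := by ring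
            _ = _ := by rw [e1]; ring
  have hfin : ∀ᵐ s, F s ≠ ∞ := by
    have h : ∀ᵐ s, F s ^ p < ∞ := ae_lt_top (by fun_prop) hNt
    filter_upwards [h] with s hs hcon
    rw [hcon, ENNReal.top_rpow_of_pos hpp] at hs
    exact lt_irrefl _ hs
  have hGint : ∫⁻ s, ∫⁻ t, G (s,t) ≤ ENNReal.ofReal C0 * N ^ (2/p) := by
    calc _ ≤ ∫⁻ s, ENNReal.ofReal (C0 * m ^ (2/p-1)) * F s ^ p := by
          refine lintegral_mono_ae ?_
          filter_upwards [hfin] with s hs using key s hs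
      _ = _ := by
          rw [lintegral_const_mul _ (by fun_prop), ← hN, hNm, ENNReal.ofReal_rpow_of_nonneg hm0.le hpi.le,
            ← ENNReal.ofReal_mul (by positivity), ← ENNReal.ofReal_mul (by positivity)]
          congr 1
          have : m ^ (2/p) = m ^ (2/p-1) * m := by rw [← Real.rpow_add_one hm0.ne']; congr 1; ring
          rw [this]; ring
  calc ∫⁻ s, ∫⁻ t, F s * F t * kf s t ≤ ∫⁻ s, ∫⁻ t, (G (s,t) + G (t,s)) := by
        refine lintegral_mono fun s => lintegral_mono fun t => ?_
        rcases le_total (F t) (F s) with h | h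
        · refine le_add_right (le_of_eq ?_)
          rw [hG, Set.indicator_of_mem (show (s,t) ∈ D from h)]
        · refine le_add_left (le_of_eq ?_)
          rw [hG, Set.indicator_of_mem (show (t,s) ∈ D from h)]
          simp only [hkf]
          rw [abs_sub_comm, mul_comm (F s)]
    _ = (∫⁻ s, ∫⁻ t, G (s,t)) + ∫⁻ s, ∫⁻ t, G (t,s) := by
        have h1 : Measurable fun s => ∫⁻ t, G (s,t) := hGm.lintegral_prod_right'
        rw [← lintegral_add_left h1]
        congr 1
        ext s
        rw [lintegral_add_left (by fun_prop)]
    _ = 2 * ∫⁻ s, ∫⁻ t, G (s,t) := by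
        rw [lintegral_lintegral_swap (f := fun s t => G (t,s)) (by
          have : Measurable fun z : ℝ × ℝ => G (z.2, z.1) := by fun_prop
          exact this.aemeasurable), two_mul]
    _ ≤ 2 * (ENNReal.ofReal C0 * N ^ (2/p)) := by gcongr
    _ = _ := by rw [ENNReal.ofReal_mul (by norm_num), ENNReal.ofReal_ofNat]; ring

end ST

namespace ST

/-- slices -/
def slc {n : ℕ} (i : Fin (n+1)) (f : E (n+1) → ℂ) (s : ℝ) (y : E n) : ℂ := f ((sl i).symm (s, y))

lemma slc_meas {n : ℕ} (i : Fin (n+1)) {f : E (n+1) → ℂ} (hf : Measurable f) :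
    Measurable (fun z : ℝ × E n => slc i f z.1 z.2) := hf.comp (sl i).symm.measurable

lemma slc_int {n : ℕ} (i : Fin (n+1)) {f : E (n+1) → ℂ} (hf : Integrable f) :
    Integrable (fun z : ℝ × E n => slc i f z.1 z.2) (volume.prod volume) :=
  ((sl_mp i).symm _).integrable_comp_emb (sl i).symm.measurableEmbedding |>.2 hf

/-- partial Fourier transform -/
def ph {n : ℕ} (i : Fin (n+1)) (f : E (n+1) → ℂ) (ω : E (n+1)) (s : ℝ) : ℂ :=
  cexp (-I * ((s * ω i : ℝ) : ℂ)) * fourierTf (slc i f s) (pr i ω)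

lemma ph_meas {n : ℕ} (i : Fin (n+1)) {f : E (n+1) → ℂ} (hf : Measurable f) :
    Measurable (fun z : E (n+1) × ℝ => ph i f z.1 z.2) := by
  have h1 := slc_meas i hf
  have hp := (pr_cont (n := n) i).measurable
  have h2 : Measurable (fun w : (E (n+1) × ℝ) × E n => 
    cexp (-I * Complex.ofReal ⟪w.2, pr i w.1.1⟫) * slc i f w.1.2 w.2) := by
    refine Measurable.mul ?_ (h1.comp (by fun_prop : Measurable fun w : (E (n+1) × ℝ) × E n => (w.1.2, w.2)))
    have : Measurable (fun w : (E (n+1) × ℝ) × E n => ⟪w.2, pr i w.1.1⟫) := by fun_prop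
    fun_prop
  have h3 := h2.stronglyMeasurable.integral_prod_right' (ν := (volume : Measure (E n)))
  refine Measurable.mul (by fun_prop) ?_
  exact h3.measurable

lemma ph_bound {n : ℕ} (i : Fin (n+1)) (f : E (n+1) → ℂ) (ω : E (n+1)) (s : ℝ) :
    ‖ph i f ω s‖ ≤ ∫ y, ‖slc i f s y‖ := by
  rw [ph, norm_mul, Complex.norm_exp]
  simp
  exact fourierTf_bound _ _

lemma ft_slice {n : ℕ} (i : Fin (n+1)) {f : E (n+1) → ℂ} (hf : Integrable f) (ω : E (n+1)) :
    fourierTf f ω = ∫ s, ph i f ω s := by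
  have h1 := ((sl_mp i).symm _).integral_comp (sl i).symm.measurableEmbedding
    (fun x => cexp (-I * Complex.ofReal ⟪x, ω⟫) * f x)
  rw [fourierTf, ← h1]
  have hi : Integrable (fun z : ℝ × E n => cexp (-I * Complex.ofReal ⟪(sl i).symm z, ω⟫) * f ((sl i).symm z))
      (volume.prod volume) := by
    refine (slc_int i hf).bdd_mul (c := 1) ?_ (Filter.Eventually.of_forall fun x => ?_)
    · have := (sl i).symm.measurable
      have : Measurable (fun z => ⟪(sl i).symm z, ω⟫) := by fun_prop
      fun_prop
    · rw [Complex.norm_exp]; simp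
  refine (integral_prod _ hi).trans ?_
  congr 1
  ext s
  rw [ph, fourierTf, ← integral_const_mul]
  congr 1
  ext y
  rw [inner_split i, sl_symm_i, sl_symm_pr, ← mul_assoc, ← Complex.exp_add, slc]
  congr 2
  push_cast
  ring

lemma coord_form {n : ℕ} (i : Fin (n+1)) {f : E (n+1) → ℂ} (hfm : Measurable f) (hf : Integrable f) :
    ∫⁻ ω : Sp (n+1), ENNReal.ofReal ((ω : E (n+1)) i ^ 2) * ‖fourierTf f ω‖ₑ ^ 2 ∂sg (n+1) ≤
      ∫⁻ s, ∫⁻ t, ‖BB i (t - s) (slc i f s) (slc i f t)‖ₑ := by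
  have hc := fourierTf_cont hf
  have hpm := ph_meas i hfm
  set g : ℝ → ℝ := fun s => ∫ y, ‖slc i f s y‖ with hg
  have hgi : Integrable g := (slc_int i hf).integral_norm_prod_left
  set Φ : Sp (n+1) × (ℝ × ℝ) → ℂ := fun w => (((w.1 : E (n+1)) i ^ 2 : ℝ) : ℂ) *
    (ph i f w.1 w.2.1 * (starRingEnd ℂ) (ph i f w.1 w.2.2)) with hΦ
  have hΦm : Measurable Φ := by
    have m1 : Measurable fun w : Sp (n+1) × (ℝ × ℝ) => ph i f w.1 w.2.1 :=
      hpm.comp (by fun_prop : Measurable fun w : Sp (n+1) × (ℝ × ℝ) => ((w.1 : E (n+1)), w.2.1))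
    have m2 : Measurable fun w : Sp (n+1) × (ℝ × ℝ) => ph i f w.1 w.2.2 :=
      hpm.comp (by fun_prop : Measurable fun w : Sp (n+1) × (ℝ × ℝ) => ((w.1 : E (n+1)), w.2.2))
    have m3 : Measurable fun w : Sp (n+1) × (ℝ × ℝ) => (starRingEnd ℂ) (ph i f w.1 w.2.2) :=
      Complex.continuous_conj.measurable.comp m2
    fun_prop
  have hΦi : Integrable Φ ((sg (n+1)).prod (volume.prod volume)) := by
    have hgg : Integrable (fun w : Sp (n+1) × (ℝ × ℝ) => g w.2.1 * g w.2.2) ((sg (n+1)).prod (volume.prod volume)) :=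
      (hgi.mul_prod hgi).comp_snd (sg (n+1))
    refine hgg.mono' hΦm.aestronglyMeasurable (Filter.Eventually.of_forall fun w => ?_)
    rw [hΦ]
    simp only
    rw [norm_mul, norm_mul, RCLike.norm_conj, Complex.norm_real, Real.norm_eq_abs, abs_pow]
    have h1 := ph_bound i f w.1 w.2.1
    have h2 := ph_bound i f w.1 w.2.2
    have h3 : |(w.1 : E (n+1)) i| ^ 2 ≤ 1 := pow_le_one₀ (abs_nonneg _) (abs_coord_le i w.1)
    calc _ ≤ 1 * (g w.2.1 * g w.2.2) := by gcongr
      _ = _ := one_mul _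
  have hsw := integral_integral_swap (f := fun (ω : Sp (n+1)) (z : ℝ × ℝ) => Φ (ω, z)) hΦi
  have e1 : ∀ ω : Sp (n+1), ∫ z : ℝ × ℝ, Φ (ω, z) ∂(volume.prod volume) =
      (((ω : E (n+1)) i ^ 2 * ‖fourierTf f ω‖ ^ 2 : ℝ) : ℂ) := by
    intro ω
    simp only [hΦ]
    rw [integral_const_mul, integral_prod_mul (fun s => ph i f ω s) (fun t => (starRingEnd ℂ) (ph i f ω t)),
      integral_conj, ← ft_slice i hf, Complex.mul_conj, Complex.normSq_eq_norm_sq]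
    push_cast
    ring
  have e2 : ∀ z : ℝ × ℝ, ∫ ω : Sp (n+1), Φ (ω, z) ∂sg (n+1) = BB i (z.2 - z.1) (slc i f z.1) (slc i f z.2) := by
    intro z
    rw [BB]
    congr 1
    ext ω
    simp only [hΦ, ph]
    rw [map_mul, ← Complex.exp_conj]
    simp only [map_mul, map_neg, conj_I, conj_ofReal, neg_neg]
    have : cexp (((z.2 - z.1) * (ω : E (n+1)) i : ℝ) * I) =
      cexp (-I * ((z.1 * (ω : E (n+1)) i : ℝ) : ℂ)) * cexp (I * ((z.2 * (ω : E (n+1)) i : ℝ) : ℂ)) := by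
      rw [← Complex.exp_add]; congr 1; push_cast; ring
    rw [this]
    ring
  simp_rw [e1, e2] at hsw
  have e3 : ∫⁻ ω : Sp (n+1), ENNReal.ofReal ((ω : E (n+1)) i ^ 2) * ‖fourierTf f ω‖ₑ ^ 2 ∂sg (n+1) =
      ‖∫ ω : Sp (n+1), (((ω : E (n+1)) i ^ 2 * ‖fourierTf f ω‖ ^ 2 : ℝ) : ℂ) ∂sg (n+1)‖ₑ := by
    rw [integral_complex_ofReal, ← ofReal_norm, Complex.norm_real,
        Real.norm_of_nonneg (integral_nonneg fun _ => by positivity), ofReal_integral_eq_lintegral_ofReal]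
    · congr 1
      ext ω
      rw [ENNReal.ofReal_mul (by positivity), ENNReal.ofReal_pow (norm_nonneg _), ofReal_norm]
    · exact integrable_sphere _ (by fun_prop)
    · exact Filter.Eventually.of_forall fun y => by positivity
  rw [e3, hsw]
  exact (enorm_integral_le_lintegral_enorm _).trans (lintegral_prod_le _)

lemma st1 (n : ℕ) (hn : 1 ≤ n) (p : ℝ) (hp : p = 2 * (n+2) / (n+4)) :
    ∃ C, 0 < C ∧ ∀ f : E (n+1) → ℂ, Measurable f → Integrable f →
      ∫⁻ ω : Sp (n+1), ‖fourierTf f ω‖ₑ ^ 2 ∂sg (n+1) ≤ ENNReal.ofReal C * (∫⁻ x, ‖f x‖ₑ ^ p) ^ (2/p) := by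
  have hn' : (1:ℝ) ≤ n := by exact_mod_cast hn
  have hp1 : 1 < p := by rw [hp, lt_div_iff₀ (by positivity)]; linarith
  have hp2 : p < 2 := by rw [hp, div_lt_iff₀ (by positivity)]; linarith
  set γ : ℝ := n / (n+2) with hγ
  have hγ' : γ = 2 - 2/p := by rw [hγ, hp]; field_simp; ring
  obtain ⟨C1, hC1, hB⟩ := BB_est n hn p γ hp hγ
  obtain ⟨C2, hC2, hH⟩ := hls p γ hp1 hp2 hγ'
  refine ⟨(n+1) * (C1 * C2), by positivity, fun f hfm hf => ?_⟩
  have hc := fourierTf_cont hf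
  have one : ∀ i : Fin (n+1), ∫⁻ ω : Sp (n+1), ENNReal.ofReal ((ω : E (n+1)) i ^ 2) * ‖fourierTf f ω‖ₑ ^ 2 ∂sg (n+1)
      ≤ ENNReal.ofReal (C1 * C2) * (∫⁻ x, ‖f x‖ₑ ^ p) ^ (2/p) := by
    intro i
    have hsm := slc_meas i hfm
    set F : ℝ → ℝ≥0∞ := fun s => (∫⁻ y, ‖slc i f s y‖ₑ ^ p) ^ (1/p) with hF
    have hFm0 : Measurable fun s => ∫⁻ y, ‖slc i f s y‖ₑ ^ p := by
      have : Measurable fun z : ℝ × E n => ‖slc i f z.1 z.2‖ₑ ^ p := by fun_prop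
      exact this.lintegral_prod_right'
    have hFm : Measurable F := hFm0.pow_const _
    have hFp : ∫⁻ s, F s ^ p = ∫⁻ x, ‖f x‖ₑ ^ p := by
      have : ∀ s, F s ^ p = ∫⁻ y, ‖slc i f s y‖ₑ ^ p := by
        intro s
        rw [hF]
        simp only
        rw [← ENNReal.rpow_mul, one_div, inv_mul_cancel₀ (by linarith), ENNReal.rpow_one]
      simp_rw [this]
      rw [← ((sl_mp i).symm _).lintegral_comp_emb (sl i).symm.measurableEmbedding]
      have hm : Measurable fun z : ℝ × E n => ‖slc i f z.1 z.2‖ₑ ^ p := by fun_prop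
      exact (lintegral_prod _ hm.aemeasurable).symm
    have hae : ∀ᵐ s, Integrable (slc i f s) := (slc_int i hf).prod_right_ae
    calc _ ≤ _ := coord_form i hfm hf
      _ ≤ ∫⁻ s, ∫⁻ t, ENNReal.ofReal C1 * (F s * F t * ENNReal.ofReal (|s-t| ^ (-γ))) := by
          refine lintegral_mono_ae ?_
          filter_upwards [hae] with s hs
          refine lintegral_mono_ae ?_
          have hne : ∀ᵐ t : ℝ, t ≠ s := by rw [ae_iff]; simp
          filter_upwards [hae, hne] with t ht hts
          refine (hB i (t-s) _ _ (sub_ne_zero.2 hts) (by fun_prop) (by fun_prop) hs ht).trans (le_of_eq ?_)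
          rw [abs_sub_comm, ENNReal.ofReal_mul hC1.le]
          ring
      _ = ENNReal.ofReal C1 * ∫⁻ s, ∫⁻ t, F s * F t * ENNReal.ofReal (|s-t| ^ (-γ)) := by
          have hm : Measurable fun z : ℝ × ℝ => F z.1 * F z.2 * ENNReal.ofReal (|z.1-z.2| ^ (-γ)) := by fun_prop
          rw [← lintegral_const_mul _ hm.lintegral_prod_right']
          congr 1
          ext s
          rw [lintegral_const_mul _ (by fun_prop)]
      _ ≤ ENNReal.ofReal C1 * (ENNReal.ofReal C2 * (∫⁻ s, F s ^ p) ^ (2/p)) := by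
          gcongr
          exact hH F hFm
      _ = _ := by rw [hFp, ← mul_assoc, ENNReal.ofReal_mul hC1.le]
  have hsum : ∀ ω : Sp (n+1), ‖fourierTf f ω‖ₑ ^ 2 =
      ∑ i, ENNReal.ofReal ((ω : E (n+1)) i ^ 2) * ‖fourierTf f ω‖ₑ ^ 2 := by
    intro ω
    rw [← Finset.sum_mul, ← ENNReal.ofReal_sum_of_nonneg (fun i _ => sq_nonneg _)]
    have h := EuclideanSpace.norm_sq_eq (ω : E (n+1))
    have h1 : ‖(ω : E (n+1))‖ = 1 := by simp
    rw [h1] at h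
    simp only [Real.norm_eq_abs, sq_abs] at h
    rw [← h]; simp
  calc _ = ∫⁻ ω : Sp (n+1), ∑ i, ENNReal.ofReal ((ω : E (n+1)) i ^ 2) * ‖fourierTf f ω‖ₑ ^ 2 ∂sg (n+1) := by
        congr 1; ext ω; exact hsum ω
    _ = ∑ i, ∫⁻ ω : Sp (n+1), ENNReal.ofReal ((ω : E (n+1)) i ^ 2) * ‖fourierTf f ω‖ₑ ^ 2 ∂sg (n+1) := by
        rw [lintegral_finsetSum]
        intro i _
        have hcm : Measurable (fun ω : Sp (n+1) => fourierTf f ω) :=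
          (hc.comp continuous_subtype_val).measurable
        have hcm2 : Measurable (fun ω : Sp (n+1) => ENNReal.ofReal ((ω : E (n+1)) i ^ 2)) := by
          fun_prop
        exact hcm2.mul (hcm.enorm.pow_const 2)
    _ ≤ ∑ i : Fin (n+1), ENNReal.ofReal (C1 * C2) * (∫⁻ x, ‖f x‖ₑ ^ p) ^ (2/p) := by
        gcongr with i
        exact one i
    _ = _ := by
        generalize hT : (∫⁻ x, ‖f x‖ₑ ^ p) ^ (2/p) = T
        have hc12 : 0 ≤ C1 * C2 := by positivity
        rw [Finset.sum_const]
        simp only [Finset.card_univ, Fintype.card_fin, nsmul_eq_mul]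
        rw [← mul_assoc, ← ENNReal.ofReal_natCast, ← ENNReal.ofReal_mul (by positivity)]
        congr 2
        push_cast; ring

end ST

namespace ST

lemma fourierTf_dil {n : ℕ} (f : E n → ℂ) (R : ℝ) (hR : 0 < R) (ω : E n) :
    fourierTf (fun x => f (R⁻¹ • x)) ω = ((R ^ n : ℝ) : ℂ) * fourierTf f (R • ω) := by
  unfold fourierTf
  have h := Measure.integral_comp_inv_smul (volume : Measure (E n))
    (fun x => cexp (-I * ((⟪x, R • ω⟫ : ℝ) : ℂ)) * f x) R
  have h2 : |R ^ Module.finrank ℝ (E n)| = R ^ n := by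
    rw [abs_of_pos (by positivity)]; simp [E]
  rw [h2] at h
  rw [← Complex.real_smul, ← h]
  congr 1
  ext x
  rw [inner_smul_left, inner_smul_right]
  simp only [conj_trivial]
  rw [← mul_assoc, inv_mul_cancel₀ hR.ne', one_mul]

end ST

theorem sphere_restriction_scaled (d : ℕ) (hd : 2 ≤ d) :
    ∃ C : ℝ, 0 < C ∧ ∀ R : ℝ, 0 < R → ∀ f : SchwartzMap (EuclideanSpace ℝ (Fin d)) ℂ,
      (ENNReal.ofReal (R ^ (d - 1)) *
          ∫⁻ ω : sphere (0 : EuclideanSpace ℝ (Fin d)) 1,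
            (‖fourierTf (fun x => f x) (R • (ω : EuclideanSpace ℝ (Fin d)))‖₊ : ℝ≥0∞) ^ 2
            ∂((volume : Measure (EuclideanSpace ℝ (Fin d))).toSphere)) ^ (1 / 2 : ℝ)
        ≤ ENNReal.ofReal (C * R ^ ((d - 1 : ℝ) / (2 * (d + 1)))) *
            eLpNorm (fun x => f x) (ENNReal.ofReal (2 * (d + 1) / (d + 3))) volume := by
  obtain ⟨n, rfl⟩ : ∃ n, d = n + 1 := ⟨d - 1, by omega⟩
  have hn : 1 ≤ n := by omega
  set p : ℝ := 2 * (((n+1 : ℕ) : ℝ) + 1) / (((n+1 : ℕ) : ℝ) + 3) with hp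
  have hp0 : 0 < p := by positivity
  obtain ⟨C, hC, hS⟩ := ST.st1 n hn p (by rw [hp]; push_cast; ring)
  refine ⟨C ^ (1/2 : ℝ), by positivity, fun R hR f => ?_⟩
  have hgm : Measurable (fun x => f (R⁻¹ • x)) := by
    have := f.continuous
    exact (this.comp (continuous_const_smul _)).measurable
  have hgi : Integrable (fun x => f (R⁻¹ • x)) :=
    (f.integrable (μ := volume)).comp_smul (inv_ne_zero hR.ne')
  have h := hS _ hgm hgi
  have hdil := ST.lintegral_dil (fun x => ‖f x‖ₑ ^ p) R hR
  rw [hdil] at h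
  have hF : ∀ ω : ST.Sp (n+1), ‖fourierTf (fun x => f (R⁻¹ • x)) (ω : ST.E (n+1))‖ₑ ^ 2
      = ENNReal.ofReal ((R ^ (n+1)) ^ 2) * ‖fourierTf (fun x => f x) (R • (ω : ST.E (n+1)))‖ₑ ^ 2 := by
    intro ω
    rw [ST.fourierTf_dil (fun x => f x) R hR, enorm_mul, mul_pow, ENNReal.ofReal_pow (by positivity)]
    congr 2
    rw [← ofReal_norm, Complex.norm_real, Real.norm_of_nonneg (by positivity)]
  simp_rw [hF] at h
  rw [lintegral_const_mul' _ _ ENNReal.ofReal_ne_top] at h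
  have hL : eLpNorm (fun x => f x) (ENNReal.ofReal p) volume = (∫⁻ x, ‖f x‖ₑ ^ p) ^ (1/p) := by
    rw [eLpNorm_eq_lintegral_rpow_enorm_toReal (by simpa using hp0) ENNReal.ofReal_ne_top,
      ENNReal.toReal_ofReal hp0.le]
  rw [hL]
  change (ENNReal.ofReal (R ^ (n + 1 - 1)) *
    ∫⁻ ω : ST.Sp (n+1), ‖fourierTf (fun x => f x) (R • (ω : ST.E (n+1)))‖ₑ ^ 2 ∂ST.sg (n+1)) ^ (1/2:ℝ) ≤ _
  generalize (∫⁻ ω : ST.Sp (n+1), ‖fourierTf (fun x => f x) (R • (ω : ST.E (n+1)))‖ₑ ^ 2 ∂ST.sg (n+1)) = A at h ⊢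
  generalize (∫⁻ x, ‖f x‖ₑ ^ p) = B at h ⊢
  have e1 : ENNReal.ofReal (R ^ (n + 1 - 1)) * A =
      ENNReal.ofReal (R ^ n * ((R ^ (n+1)) ^ 2)⁻¹) * (ENNReal.ofReal ((R ^ (n+1)) ^ 2) * A) := by
    rw [← mul_assoc, ← ENNReal.ofReal_mul (by positivity)]
    congr 2
    simp only [Nat.add_sub_cancel]
    field_simp
  rw [e1]
  calc _ ≤ (ENNReal.ofReal (R ^ n * ((R ^ (n+1)) ^ 2)⁻¹) *
        (ENNReal.ofReal C * (ENNReal.ofReal (R ^ (n+1)) * B) ^ (2/p))) ^ (1/2 : ℝ) := by gcongr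
    _ = _ := by
      rw [ENNReal.mul_rpow_of_nonneg _ _ (by positivity : 0 ≤ 2/p), ENNReal.ofReal_rpow_of_pos (by positivity),
        ← mul_assoc, ← mul_assoc, ← ENNReal.ofReal_mul (by positivity), ← ENNReal.ofReal_mul (by positivity),
        ENNReal.mul_rpow_of_nonneg _ _ (by norm_num), ENNReal.ofReal_rpow_of_pos (by positivity),
        ← ENNReal.rpow_mul]
      congr 2
      · rw [← Real.rpow_natCast, ← Real.rpow_natCast, ← Real.rpow_natCast, ← Real.rpow_mul hR.le,
          ← Real.rpow_neg hR.le, ← Real.rpow_mul hR.le, ← Real.rpow_add hR, mul_right_comm,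
          ← Real.rpow_add hR, mul_comm, Real.mul_rpow hC.le (by positivity), ← Real.rpow_mul hR.le]
        congr 2
        rw [hp]
        push_cast
        field_simp
        ring
      · field_simp

end
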